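/- arXiv:2506.21823 — 2 statements merged into one kernel-verified Lean document; each statement's English description precedes it below -/
import Mathlib

section
/- For every real number x ≥ 2, the sum T₃(x) = ∑_{n ≤ x} d₃(n) satisfies |T₃(x) − x(½(log x)² + (3γ − 1)log x + 3γ² − 3γ − 3γ₁ + 1)| ≤ 3.369 · x^{2/3} · (log x)^{1/3}. -/
open Finset Real Filter

/-- `dk k n` is the number of ways to write `n` as an ordered product of `k`
positive integers (the `k`-fold Dirichlet convolution of the constant
function `1`). -/
noncomputable def dk (k n : ℕ) : ℕ := (ArithmeticFunction.zeta ^ k) n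

/-- `Tk k x = ∑_{n ≤ x} d_k(n)`. -/
noncomputable def Tk (k : ℕ) (x : ℝ) : ℝ := ∑ n ∈ Finset.Icc 1 ⌊x⌋₊, (dk k n : ℝ)

theorem two_mul_div_le_log {s : ℝ} (hs : 1 ≤ s) : 2 * (s - 1) / (s + 1) ≤ log s := by
  have h := le_log_one_add_of_nonneg (sub_nonneg.2 hs)
  rwa [show s - 1 + 2 = s + 1 by ring, show 1 + (s - 1) = s by ring] at h

theorem log_le_half_sub_inv {s : ℝ} (hs : 1 ≤ s) : log s ≤ (s - 1 / s) / 2 := by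
  have hmono : MonotoneOn (fun t : ℝ => (t - 1 / t) / 2 - log t) (Set.Ici 1) := by
    apply monotoneOn_of_hasDerivWithinAt_nonneg (convex_Ici 1)
      (f' := fun t : ℝ => (1 - (-1 / t ^ 2)) / 2 - t⁻¹)
    · intro t ht
      have ht0 : t ≠ 0 := by simp only [Set.mem_Ici] at ht; positivity
      exact ContinuousAt.continuousWithinAt (by fun_prop (disch := assumption))
    · intro t ht
      rw [interior_Ici, Set.mem_Ioi] at ht
      have ht0 : t ≠ 0 := by positivity
      have h1 : HasDerivAt (fun t : ℝ => 1 / t) (-1 / t ^ 2) t := by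
        simpa [neg_div] using hasDerivAt_inv ht0
      exact ((((hasDerivAt_id t).sub h1).div_const 2).sub (hasDerivAt_log ht0)).hasDerivWithinAt
    · intro t ht
      rw [interior_Ici, Set.mem_Ioi] at ht
      have ht0 : 0 < t := by positivity
      have : (1 - (-1 / t ^ 2)) / 2 - t⁻¹ = (t - 1) ^ 2 / (2 * t ^ 2) := by
        field_simp; ring
      rw [this]; positivity
  have := hmono (Set.mem_Ici.2 le_rfl) (Set.mem_Ici.2 hs) hs
  simp only [log_one] at this
  linarith

theorem half_sub_inv_sub_le_log {s : ℝ} (hs : 1 ≤ s) :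
    (s - 1 / s) / 2 - ((s - 1) ^ 2 - (1 - 1 / s) ^ 2) / 12 ≤ log s := by
  have hmono : MonotoneOn (fun t : ℝ => log t - ((t - 1 / t) / 2 -
      ((t - 1) ^ 2 - (1 - 1 / t) ^ 2) / 12)) (Set.Ici 1) := by
    apply monotoneOn_of_hasDerivWithinAt_nonneg (convex_Ici 1)
      (f' := fun t : ℝ => t⁻¹ - ((1 - (-1 / t ^ 2)) / 2 -
        (2 * (t - 1) - 2 * (1 - 1 / t) * (1 / t ^ 2)) / 12))
    · intro t ht
      have ht0 : t ≠ 0 := by simp only [Set.mem_Ici] at ht; positivity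
      exact ContinuousAt.continuousWithinAt (by fun_prop (disch := assumption))
    · intro t ht
      rw [interior_Ici, Set.mem_Ioi] at ht
      have ht0 : t ≠ 0 := by positivity
      have h1 : HasDerivAt (fun t : ℝ => 1 / t) (-1 / t ^ 2) t := by
        simpa [neg_div] using hasDerivAt_inv ht0
      have h2 : HasDerivAt (fun t : ℝ => (t - 1) ^ 2) (2 * (t - 1)) t := by
        exact (((hasDerivAt_id t).sub_const 1).pow 2).congr_deriv (by simp)
      have h3 : HasDerivAt (fun t : ℝ => (1 - 1 / t) ^ 2) (2 * (1 - 1 / t) * (1 / t ^ 2)) t := by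
        exact ((h1.const_sub 1).pow 2).congr_deriv (by push_cast; ring)
      exact ((hasDerivAt_log ht0).sub ((((hasDerivAt_id t).sub h1).div_const 2).sub
        ((h2.sub h3).div_const 12))).hasDerivWithinAt
    · intro t ht
      rw [interior_Ici, Set.mem_Ioi] at ht
      have ht0 : 0 < t := by positivity
      have : t⁻¹ - ((1 - (-1 / t ^ 2)) / 2 -
        (2 * (t - 1) - 2 * (1 - 1 / t) * (1 / t ^ 2)) / 12) = (t - 1) ^ 4 / (6 * t ^ 3) := by
        field_simp; ring
      rw [this]; positivity
  have := hmono (Set.mem_Ici.2 le_rfl) (Set.mem_Ici.2 hs) hs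
  simp only [log_one] at this
  linarith

/-- Error of the trapezoidal rule for `1 / t` on `[n, n + 1]`, lower bound. -/
theorem log_succ_sub_le {n : ℕ} (hn : 1 ≤ n) :
    log (n + 1) - log n ≤ (1 / (n : ℝ) + 1 / (n + 1)) / 2 := by
  have hn' : (1 : ℝ) ≤ n := by exact_mod_cast hn
  rw [← log_div (by positivity) (by positivity)]
  refine (log_le_half_sub_inv ?_).trans_eq ?_
  · rw [le_div_iff₀ (by positivity)]; linarith
  · field_simp; ring

/-- Error of the trapezoidal rule for `1 / t` on `[n, n + 1]`, upper bound. -/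
theorem le_log_succ_sub {n : ℕ} (hn : 1 ≤ n) :
    (1 / (n : ℝ) + 1 / (n + 1)) / 2 - (1 / (n : ℝ) ^ 2 - 1 / ((n : ℝ) + 1) ^ 2) / 12 ≤
      log (n + 1) - log n := by
  have hn' : (1 : ℝ) ≤ n := by exact_mod_cast hn
  rw [← log_div (by positivity) (by positivity)]
  refine le_trans (le_of_eq ?_) (half_sub_inv_sub_le_log ?_)
  · field_simp; ring
  · rw [le_div_iff₀ (by positivity)]; linarith

theorem le_of_tendsto_of_le_succ {f : ℕ → ℝ} {A : ℕ} {l : ℝ} (h : ∀ n, A ≤ n → f n ≤ f (n + 1))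
    (hl : Tendsto f atTop (nhds l)) : f A ≤ l := by
  refine ge_of_tendsto hl (eventually_atTop.2 ⟨A, fun n hn => ?_⟩)
  induction n, hn using Nat.le_induction with
  | base => exact le_rfl
  | succ n hn ih => exact ih.trans (h n hn)

/-- The harmonic sum `∑_{i ≤ n} 1 / i`. -/
noncomputable def harmonicSum (n : ℕ) : ℝ := ∑ i ∈ Icc 1 n, 1 / (i : ℝ)

/-- The sum `∑_{i ≤ n} log i / i`. -/
noncomputable def logHarmonicSum (n : ℕ) : ℝ := ∑ i ∈ Icc 1 n, log i / i

theorem harmonicSum_succ (n : ℕ) : harmonicSum (n + 1) = harmonicSum n + 1 / ((n : ℝ) + 1) := by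
  rw [harmonicSum, sum_Icc_succ_top (by omega)]; push_cast; rfl

theorem logHarmonicSum_succ (n : ℕ) :
    logHarmonicSum (n + 1) = logHarmonicSum n + log ((n : ℝ) + 1) / ((n : ℝ) + 1) := by
  rw [logHarmonicSum, sum_Icc_succ_top (by omega)]; push_cast; rfl

theorem tendsto_harmonicSum_sub_log_sub :
    Tendsto (fun n : ℕ => harmonicSum n - log n - 1 / (2 * (n : ℝ))) atTop
      (nhds eulerMascheroniConstant) := by
  have h1 := tendsto_harmonic_sub_log
  have h2 : Tendsto (fun n : ℕ => 1 / (2 * (n : ℝ))) atTop (nhds 0) := by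
    have := tendsto_one_div_atTop_nhds_zero_nat (𝕜 := ℝ)
    simpa [mul_comm, div_eq_mul_inv] using this.mul_const (1 / 2 : ℝ)
  have := h1.sub h2
  rw [sub_zero] at this
  refine this.congr fun n => ?_
  rw [harmonicSum, harmonic_eq_sum_Icc]
  push_cast
  simp

theorem tendsto_one_div_sq_nat : Tendsto (fun n : ℕ => 1 / (n : ℝ) ^ 2) atTop (nhds 0) := by
  have := tendsto_one_div_atTop_nhds_zero_nat (𝕜 := ℝ)
  simpa using this.pow 2

theorem tendsto_log_div_nat : Tendsto (fun n : ℕ => log n / (n : ℝ)) atTop (nhds 0) := by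
  exact (isLittleO_log_id_atTop.tendsto_div_nhds_zero).comp
    (tendsto_natCast_atTop_atTop (R := ℝ))

theorem harmonicSum_le_of_pos {n : ℕ} (hn : 1 ≤ n) :
    harmonicSum n - log n - 1 / (2 * (n : ℝ)) ≤ eulerMascheroniConstant := by
  refine le_of_tendsto_of_le_succ
    (f := fun n : ℕ => harmonicSum n - log n - 1 / (2 * (n : ℝ))) (fun m hm => ?_)
    tendsto_harmonicSum_sub_log_sub
  have h := log_succ_sub_le (hn.trans hm)
  have hm' : (1 : ℝ) ≤ m := by exact_mod_cast hn.trans hm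
  rw [harmonicSum_succ]
  push_cast
  have e1 : 1 / (2 * (m : ℝ)) = (1 / (m : ℝ)) / 2 := by field_simp
  have e2 : 1 / (2 * ((m : ℝ) + 1)) = (1 / ((m : ℝ) + 1)) / 2 := by field_simp
  rw [e1, e2]
  linarith

theorem le_harmonicSum_of_pos {n : ℕ} (hn : 1 ≤ n) :
    eulerMascheroniConstant ≤ harmonicSum n - log n - 1 / (2 * (n : ℝ)) + 1 / (n : ℝ) ^ 2 / 12 := by
  have key := le_of_tendsto_of_le_succ (A := n) (l := -eulerMascheroniConstant)
    (f := fun n : ℕ => -(harmonicSum n - log n - 1 / (2 * (n : ℝ)) + 1 / (n : ℝ) ^ 2 / 12))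
    (fun m hm => ?_) ?_
  · linarith
  · have h := le_log_succ_sub (hn.trans hm)
    have hm' : (1 : ℝ) ≤ m := by exact_mod_cast hn.trans hm
    rw [harmonicSum_succ]
    push_cast
    have e1 : 1 / (2 * (m : ℝ)) = (1 / (m : ℝ)) / 2 := by field_simp
    have e2 : 1 / (2 * ((m : ℝ) + 1)) = (1 / ((m : ℝ) + 1)) / 2 := by field_simp
    rw [e1, e2]
    linarith
  · have := (tendsto_harmonicSum_sub_log_sub.add (tendsto_one_div_sq_nat.div_const 12)).neg
    simpa using this

/-- The sequence `∑_{i ≤ n} (log i - c) / i`, with its first Euler–Maclaurin terms removed. -/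
noncomputable def shiftedSeq (c : ℝ) (n : ℕ) : ℝ :=
  logHarmonicSum n - log n ^ 2 / 2 - log n / (2 * n) -
    c * (harmonicSum n - log n - 1 / (2 * (n : ℝ)))

theorem tendsto_shiftedSeq {γ₁ : ℝ}
    (hγ₁ : Tendsto (fun N : ℕ => logHarmonicSum N - (log N) ^ 2 / 2) atTop (nhds γ₁)) (c : ℝ) :
    Tendsto (shiftedSeq c) atTop (nhds (γ₁ - c * eulerMascheroniConstant)) := by
  have h := (hγ₁.sub (tendsto_log_div_nat.mul_const (1 / 2))).sub
    (tendsto_harmonicSum_sub_log_sub.const_mul c)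
  rw [zero_mul, sub_zero] at h
  refine h.congr fun n => ?_
  rw [shiftedSeq]
  ring

theorem shiftedSeq_succ_sub (c : ℝ) {n : ℕ} (hn : 1 ≤ n) :
    shiftedSeq c (n + 1) - shiftedSeq c n =
      (log n - c) * ((1 / (n : ℝ) + 1 / (n + 1)) / 2 - (log (n + 1) - log n)) -
      (log (n + 1) - log n) * ((log (n + 1) - log n) - 1 / (n + 1)) / 2 := by
  have hn' : (1 : ℝ) ≤ n := by exact_mod_cast hn
  rw [shiftedSeq, shiftedSeq, logHarmonicSum_succ, harmonicSum_succ]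
  push_cast
  field_simp
  ring

theorem log_succ_sub_log_bounds {n : ℕ} (hn : 1 ≤ n) :
    1 / ((n : ℝ) + 1) ≤ log (n + 1) - log n ∧ log (n + 1) - log n ≤ 1 / (n : ℝ) := by
  have hn' : (1 : ℝ) ≤ n := by exact_mod_cast hn
  rw [← log_div (by positivity) (by positivity)]
  constructor
  · refine le_trans (le_of_eq ?_) (one_sub_inv_le_log_of_pos (by positivity))
    field_simp; ring
  · refine (log_le_sub_one_of_pos (by positivity)).trans_eq ?_
    field_simp; ring

theorem shiftedSeq_log_le {γ₁ : ℝ}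
    (hγ₁ : Tendsto (fun N : ℕ => logHarmonicSum N - (log N) ^ 2 / 2) atTop (nhds γ₁))
    {A : ℕ} (hA : 1 ≤ A) :
    shiftedSeq (log A) A - 1 / (A : ℝ) ^ 2 / 8 ≤ γ₁ - log A * eulerMascheroniConstant := by
  refine le_of_tendsto_of_le_succ
    (f := fun n : ℕ => shiftedSeq (log A) n - 1 / (n : ℝ) ^ 2 / 8) (fun m hm => ?_) ?_
  · have hm1 := hA.trans hm
    have hm' : (1 : ℝ) ≤ m := by exact_mod_cast hm1
    have h1 := shiftedSeq_succ_sub (log A) hm1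
    have h2 := log_succ_sub_le hm1
    have h3 := log_succ_sub_log_bounds hm1
    have h4 : log A ≤ log m := log_le_log (by positivity) (by exact_mod_cast hm)
    have h5 := mul_nonneg (sub_nonneg.2 h4) (sub_nonneg.2 h2)
    have h6 : (log (m + 1) - log m) * ((log (m + 1) - log m) - 1 / (m + 1)) ≤
        ((1 / (m : ℝ) + 1 / (m + 1)) / 2) * ((1 / (m : ℝ) + 1 / (m + 1)) / 2 - 1 / (m + 1)) :=
      mul_le_mul h2 (by linarith) (by linarith) (by positivity)
    have h7 : ((1 / (m : ℝ) + 1 / (m + 1)) / 2) * ((1 / (m : ℝ) + 1 / (m + 1)) / 2 - 1 / (m + 1))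
        = (1 / (m : ℝ) ^ 2 - 1 / ((m : ℝ) + 1) ^ 2) / 4 := by
      field_simp; ring
    push_cast
    linarith
  · have := (tendsto_shiftedSeq hγ₁ (log A)).sub (tendsto_one_div_sq_nat.div_const 8)
    simpa using this

theorem le_shiftedSeq_log {γ₁ : ℝ}
    (hγ₁ : Tendsto (fun N : ℕ => logHarmonicSum N - (log N) ^ 2 / 2) atTop (nhds γ₁))
    {A : ℕ} (hA : 1 ≤ A) :
    γ₁ - log A * eulerMascheroniConstant ≤ shiftedSeq (log A) A + 1 / (A : ℝ) ^ 2 / 24 := by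
  have key := le_of_tendsto_of_le_succ (A := A) (l := -(γ₁ - log A * eulerMascheroniConstant))
    (f := fun n : ℕ => -(shiftedSeq (log A) n +
      (log n - log A + 1 / 2) * (1 / (n : ℝ) ^ 2) / 12)) (fun m hm => ?_) ?_
  · simp only [sub_self, zero_add] at key
    linarith
  · have hm1 := hA.trans hm
    have hm' : (1 : ℝ) ≤ m := by exact_mod_cast hm1
    have h1 := shiftedSeq_succ_sub (log A) hm1
    have h2 := le_log_succ_sub hm1
    have h3 := log_succ_sub_log_bounds hm1
    have h4 : log A ≤ log m := log_le_log (by positivity) (by exact_mod_cast hm)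
    have h5 := mul_nonneg (sub_nonneg.2 h4) (sub_nonneg.2 h2)
    have h0 : 0 ≤ 1 / ((m : ℝ) + 1) := by positivity
    have h6 : 0 ≤ (log (m + 1) - log m) * ((log (m + 1) - log m) - 1 / (m + 1)) :=
      mul_nonneg (by linarith) (by linarith)
    have h7 : (log (m + 1) - log m) * (1 / ((m : ℝ) + 1) ^ 2) ≤
        1 / (m : ℝ) * (1 / ((m : ℝ) + 1) ^ 2) :=
      mul_le_mul_of_nonneg_right h3.2 (by positivity)
    have h8 : 1 / (m : ℝ) * (1 / ((m : ℝ) + 1) ^ 2) ≤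
        (1 / 2) * (1 / (m : ℝ) ^ 2 - 1 / ((m : ℝ) + 1) ^ 2) := by
      rw [← sub_nonneg]
      have : (1 / 2) * (1 / (m : ℝ) ^ 2 - 1 / ((m : ℝ) + 1) ^ 2) -
        1 / (m : ℝ) * (1 / ((m : ℝ) + 1) ^ 2) = 1 / (2 * (m : ℝ) ^ 2 * ((m : ℝ) + 1) ^ 2) := by
        field_simp; ring
      rw [this]; positivity
    push_cast
    linarith
  · have h1 : Tendsto (fun n : ℕ => log n * (1 / (n : ℝ) ^ 2)) atTop (nhds 0) := by
      have := tendsto_log_div_nat.mul (tendsto_one_div_atTop_nhds_zero_nat (𝕜 := ℝ))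
      rw [zero_mul] at this
      refine this.congr fun n => ?_
      ring
    have h2 := ((tendsto_shiftedSeq hγ₁ (log A)).add ((h1.add
      (tendsto_one_div_sq_nat.const_mul (1 / 2 - log A))).div_const 12)).neg
    simp only [mul_zero, add_zero, zero_div] at h2
    refine h2.congr fun n => ?_
    ring

theorem abs_harmonicSum_floor_le {t : ℝ} (ht : 1 ≤ t) :
    |t * (harmonicSum ⌊t⌋₊ - log t - eulerMascheroniConstant + 1) - ⌊t⌋₊ - 1 / 2| ≤
      1 / (3 * t) := by
  have hN : 1 ≤ ⌊t⌋₊ := Nat.one_le_floor_iff t |>.2 ht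
  have hN' : (1 : ℝ) ≤ ⌊t⌋₊ := by exact_mod_cast hN
  have hle : (⌊t⌋₊ : ℝ) ≤ t := Nat.floor_le (by linarith)
  have hlt : t < ⌊t⌋₊ + 1 := Nat.lt_floor_add_one t
  have h1 := harmonicSum_le_of_pos hN
  have h2 := le_harmonicSum_of_pos hN
  generalize harmonicSum ⌊t⌋₊ = H at *
  generalize (⌊t⌋₊ : ℝ) = n at *
  have hn0 : 0 < n := by linarith
  have ht0 : 0 < t := by linarith
  have hs : 1 ≤ t / n := by rw [le_div_iff₀ hn0]; linarith
  have hlog : log (t / n) = log t - log n := log_div ht0.ne' hn0.ne'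
  have h3 := two_mul_div_le_log hs
  have h4 := log_le_half_sub_inv hs
  rw [hlog] at h3 h4
  rw [abs_le]
  constructor
  · have h5 : 1 / (2 * n) - 1 / n ^ 2 / 12 - (t / n - 1 / (t / n)) / 2 ≤
        H - log t - eulerMascheroniConstant := by linarith
    have h6 := mul_le_mul_of_nonneg_left h5 ht0.le
    have h7 : t * (1 / (2 * n) - 1 / n ^ 2 / 12 - (t / n - 1 / (t / n)) / 2) =
        n + 1 / 2 - t + (t - n) * (n + 1 - t) / (2 * n) - t / (12 * n ^ 2) := by
      field_simp; ring
    have h8 : t / (12 * n ^ 2) ≤ 1 / (3 * t) := by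
      rw [div_le_div_iff₀ (by positivity) (by positivity)]
      nlinarith
    have h9 : 0 ≤ (t - n) * (n + 1 - t) / (2 * n) :=
      div_nonneg (mul_nonneg (by linarith) (by linarith)) (by linarith)
    linarith
  · have h5 : H - log t - eulerMascheroniConstant ≤
        1 / (2 * n) - 2 * (t / n - 1) / (t / n + 1) := by linarith
    have h6 := mul_le_mul_of_nonneg_left h5 ht0.le
    obtain ⟨θ, rfl⟩ : ∃ θ, t = n + θ := ⟨t - n, by ring⟩
    have h7 : (n + θ) * (1 / (2 * n) - 2 * ((n + θ) / n - 1) / ((n + θ) / n + 1)) =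
        n + 1 / 2 - (n + θ) + θ * (2 * n + θ - 2 * n * θ) / (2 * n * (2 * n + θ)) := by
      have h : (n + θ) / n + 1 = (2 * n + θ) / n := by field_simp; ring
      have h' : 0 < 2 * n + θ := by linarith
      rw [h]
      obtain ⟨m, hm⟩ : ∃ m, m = 2 * n + θ := ⟨_, rfl⟩
      rw [← hm] at h' ⊢
      field_simp
      rw [show θ = m - 2 * n by linarith]
      ring
    have h8 : θ * (2 * n + θ - 2 * n * θ) / (2 * n * (2 * n + θ)) ≤ 1 / (3 * (n + θ)) := by
      have hθ0 : 0 ≤ θ := by linarith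
      have hθ1 : θ ≤ 1 := by linarith
      rw [div_le_div_iff₀ (by positivity) (by positivity)]
      obtain ⟨p, rfl⟩ : ∃ p, n = 1 + p := ⟨n - 1, by ring⟩
      have hp : 0 ≤ p := by linarith
      have c0 : 0 ≤ (1 - θ) * (4 - 3 * θ ^ 2) := mul_nonneg (by linarith) (by nlinarith)
      have c1 : 0 ≤ 8 - 10 * θ + 3 * θ ^ 2 + 6 * θ ^ 3 := by
        nlinarith [mul_nonneg hθ0 (sq_nonneg (θ - 1 / 2)), sq_nonneg (θ - 1 / 2)]
      have c2 : 0 ≤ 4 - 6 * θ * (1 - θ) := by nlinarith [sq_nonneg (θ - 1 / 2)]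
      linarith [mul_nonneg c1 hp, mul_nonneg c2 (sq_nonneg p)]
    linarith

theorem sum_Icc_sum_divisorsAntidiagonal (F : ℕ → ℕ → ℝ) (Y : ℕ) :
    ∑ n ∈ Icc 1 Y, ∑ p ∈ n.divisorsAntidiagonal, F p.1 p.2 =
      ∑ a ∈ Icc 1 Y, ∑ b ∈ Icc 1 (Y / a), F a b := by
  rw [sum_sigma', sum_sigma']
  refine sum_nbij' (fun x => ⟨x.2.1, x.2.2⟩) (fun x => ⟨x.1 * x.2, (x.1, x.2)⟩) ?_ ?_ ?_ ?_ ?_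
  · rintro ⟨n, a, b⟩ h
    simp only [mem_sigma, mem_Icc, Nat.mem_divisorsAntidiagonal] at h ⊢
    obtain ⟨⟨hn, hY⟩, rfl, h0⟩ := h
    have ha : 1 ≤ a := Nat.pos_of_ne_zero (left_ne_zero_of_mul h0)
    have hb : 1 ≤ b := Nat.pos_of_ne_zero (right_ne_zero_of_mul h0)
    refine ⟨⟨ha, (Nat.le_mul_of_pos_right a hb).trans hY⟩, hb, ?_⟩
    rw [Nat.le_div_iff_mul_le ha, mul_comm]; exact hY
  · rintro ⟨a, b⟩ h
    simp only [mem_sigma, mem_Icc, Nat.mem_divisorsAntidiagonal] at h ⊢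
    obtain ⟨⟨ha, -⟩, hb, hab⟩ := h
    rw [Nat.le_div_iff_mul_le ha, mul_comm] at hab
    have := Nat.mul_pos ha hb
    exact ⟨⟨this, hab⟩, trivial, this.ne'⟩
  · rintro ⟨n, a, b⟩ h
    simp only [mem_sigma, mem_Icc, Nat.mem_divisorsAntidiagonal] at h ⊢
    obtain ⟨-, rfl, -⟩ := h
    rfl
  · rintro ⟨a, b⟩ -; rfl
  · rintro ⟨n, a, b⟩ -; rfl

/-- The Dirichlet hyperbola method. -/
theorem sum_sum_Icc_div_eq (F : ℕ → ℕ → ℝ) {A B X : ℕ} (hAX : A ≤ X)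
    (h2 : X < (A + 1) * (B + 1)) :
    ∑ a ∈ Icc 1 X, ∑ b ∈ Icc 1 (X / a), F a b =
      ∑ a ∈ Icc 1 A, ∑ b ∈ Icc 1 (X / a), F a b +
        ∑ b ∈ Icc 1 B, ∑ a ∈ Icc (A + 1) (X / b), F a b := by
  have h3 : ∑ b ∈ Icc 1 B, ∑ a ∈ Icc (A + 1) (X / b), F a b =
      ∑ a ∈ Icc (A + 1) X, ∑ b ∈ Icc 1 (X / a), F a b := by
    refine sum_comm' fun b a => ?_
    simp only [mem_Icc]
    constructor
    · rintro ⟨⟨hb, -⟩, ha, hab⟩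
      rw [Nat.le_div_iff_mul_le hb] at hab
      refine ⟨⟨hb, ?_⟩, ha, (Nat.le_mul_of_pos_right a hb).trans hab⟩
      rw [Nat.le_div_iff_mul_le (by omega), mul_comm]; exact hab
    · rintro ⟨⟨hb, hab⟩, ha, -⟩
      rw [Nat.le_div_iff_mul_le (by omega), mul_comm] at hab
      refine ⟨⟨hb, ?_⟩, ha, by rwa [Nat.le_div_iff_mul_le hb]⟩
      by_contra! hB
      have : (A + 1) * (B + 1) ≤ a * b := Nat.mul_le_mul ha hB
      omega
  have e0 (m : ℕ) : Icc 1 m = Ioc 0 m := Icc_add_one_left_eq_Ioc 0 m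
  rw [h3, e0 X, e0 A, Icc_add_one_left_eq_Ioc, sum_Ioc_consecutive _ (Nat.zero_le A) hAX]

theorem dk_two_eq_sum {n : ℕ} : (dk 2 n : ℝ) = ∑ _p ∈ n.divisorsAntidiagonal, (1 : ℝ) := by
  rw [dk, pow_two, ArithmeticFunction.mul_apply]
  push_cast
  refine sum_congr rfl fun p hp => ?_
  have h := Nat.ne_zero_of_mem_divisorsAntidiagonal hp
  simp [ArithmeticFunction.zeta_apply, h.1, h.2]

theorem dk_three_eq_sum {n : ℕ} :
    (dk 3 n : ℝ) = ∑ p ∈ n.divisorsAntidiagonal, (dk 2 p.2 : ℝ) := by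
  rw [dk, pow_succ', ArithmeticFunction.mul_apply]
  push_cast
  refine sum_congr rfl fun p hp => ?_
  have h := Nat.ne_zero_of_mem_divisorsAntidiagonal hp
  simp [ArithmeticFunction.zeta_apply, h.1, dk]

theorem sum_dk_two_mul (g : ℕ → ℝ) (Y : ℕ) :
    ∑ n ∈ Icc 1 Y, (dk 2 n : ℝ) * g n = ∑ a ∈ Icc 1 Y, ∑ b ∈ Icc 1 (Y / a), g (a * b) := by
  rw [← sum_Icc_sum_divisorsAntidiagonal (fun a b => g (a * b))]
  refine sum_congr rfl fun n _ => ?_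
  rw [dk_two_eq_sum, sum_mul]
  refine sum_congr rfl fun p hp => ?_
  rw [one_mul, (Nat.mem_divisorsAntidiagonal.1 hp).1]

theorem sum_dk_two_mul_eq (g : ℕ → ℝ) {Y : ℕ} :
    ∑ n ∈ Icc 1 Y, (dk 2 n : ℝ) * g n =
      2 * ∑ a ∈ Icc 1 Y.sqrt, ∑ b ∈ Icc 1 (Y / a), g (a * b) -
        ∑ a ∈ Icc 1 Y.sqrt, ∑ b ∈ Icc 1 Y.sqrt, g (a * b) := by
  rw [sum_dk_two_mul, sum_sum_Icc_div_eq _ (Nat.sqrt_le_self Y)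
    (Nat.lt_succ_sqrt Y), two_mul, add_sub_assoc, ← sum_sub_distrib]
  congr 1
  refine sum_congr rfl fun b hb => ?_
  have hb' := mem_Icc.1 hb
  have : Y.sqrt ≤ Y / b := by
    rw [Nat.le_div_iff_mul_le hb'.1]
    exact (Nat.mul_le_mul_left _ hb'.2).trans (Nat.sqrt_le Y)
  have e0 (m : ℕ) : Icc 1 m = Ioc 0 m := Icc_add_one_left_eq_Ioc 0 m
  rw [e0, e0, Icc_add_one_left_eq_Ioc, ← sum_Ioc_consecutive _ (Nat.zero_le _) this]
  simp only [mul_comm]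
  ring

theorem floor_sqrt_eq {y : ℝ} (hy : 0 ≤ y) : ⌊√y⌋₊ = Nat.sqrt ⌊y⌋₊ := by
  refine eq_of_forall_le_iff fun m => ?_
  rw [Nat.le_floor_iff (sqrt_nonneg y), Nat.le_sqrt, Nat.le_floor_iff hy,
    le_sqrt (Nat.cast_nonneg m) hy]
  push_cast
  rw [pow_two]

theorem abs_Tk_two_sub_le {y : ℝ} (hy : 1 ≤ y) :
    |Tk 2 y - y * (log y + 2 * eulerMascheroniConstant - 1)| ≤ √y + 2 / 3 := by
  have hu : 1 ≤ √y := one_le_sqrt.2 hy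
  have hR := abs_harmonicSum_floor_le hu
  have hy2 : √y * √y = y := mul_self_sqrt (by linarith)
  have hlog : log (√y) = log y / 2 := log_sqrt (by linarith)
  have hT : Tk 2 y = 2 * ∑ a ∈ Icc 1 ⌊√y⌋₊, ((⌊y⌋₊ / a : ℕ) : ℝ) - (⌊√y⌋₊ : ℝ) ^ 2 := by
    have := sum_dk_two_mul_eq (fun _ => 1) (Y := ⌊y⌋₊)
    simp only [mul_one] at this
    rw [Tk, this, floor_sqrt_eq (by linarith)]
    simp [pow_two]
  have hup : ∑ a ∈ Icc 1 ⌊√y⌋₊, ((⌊y⌋₊ / a : ℕ) : ℝ) ≤ y * harmonicSum ⌊√y⌋₊ := by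
    rw [harmonicSum, mul_sum]
    refine sum_le_sum fun a _ => ?_
    rw [← Nat.floor_div_natCast, mul_one_div]
    exact Nat.floor_le (by positivity)
  have hlo : y * harmonicSum ⌊√y⌋₊ - ⌊√y⌋₊ ≤ ∑ a ∈ Icc 1 ⌊√y⌋₊, ((⌊y⌋₊ / a : ℕ) : ℝ) := by
    have : y * harmonicSum ⌊√y⌋₊ - ⌊√y⌋₊ = ∑ a ∈ Icc 1 ⌊√y⌋₊, (y * (1 / (a : ℝ)) - 1) := by
      rw [harmonicSum, mul_sum, sum_sub_distrib]; simp
    rw [this]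
    refine sum_le_sum fun a _ => ?_
    rw [← Nat.floor_div_natCast, mul_one_div]
    exact (Nat.sub_one_lt_floor _).le
  have hle : (⌊√y⌋₊ : ℝ) ≤ √y := Nat.floor_le (by linarith)
  have hlt : √y < ⌊√y⌋₊ + 1 := Nat.lt_floor_add_one _
  rw [hT]
  rw [hlog] at hR
  generalize ∑ a ∈ Icc 1 ⌊√y⌋₊, ((⌊y⌋₊ / a : ℕ) : ℝ) = S at *
  generalize harmonicSum ⌊√y⌋₊ = H at *
  generalize (⌊√y⌋₊ : ℝ) = n at *
  generalize √y = u at *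
  have h3 : 2 * u * |u * (H - log y / 2 - eulerMascheroniConstant + 1) - n - 1 / 2| ≤ 2 / 3 := by
    refine (mul_le_mul_of_nonneg_left hR (by linarith)).trans_eq ?_
    field_simp
  rw [← abs_of_nonneg (show 0 ≤ 2 * u by linarith), ← abs_mul] at h3
  have h4 := abs_le.1 h3
  have h5 : 2 * u * (u * (H - log y / 2 - eulerMascheroniConstant + 1) - n - 1 / 2) =
      2 * (y * H) - y * (log y + 2 * eulerMascheroniConstant - 1) + y - 2 * u * n - u := by
    rw [← hy2]; ring
  rw [h5] at h4
  have h6 : y - 2 * u * n + n ^ 2 = (u - n) ^ 2 := by rw [← hy2]; ring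
  have h7 : (u - n) ^ 2 ≤ u - n := by nlinarith
  have h8 := sq_nonneg (u - n)
  rw [abs_le]
  constructor <;> linarith [h4.1, h4.2]

theorem hyperbola_error_bounds {v c l : ℝ} (hv : 0 ≤ v) (hvc : v ≤ c)
    (h1 : 2 * v / (2 + v) ≤ l) (h2 : l ≤ v * (2 + v) / (2 * (1 + v))) :
    0 ≤ (1 + c) * (1 / (1 + v) ^ 2 - 1 + 2 * l) - 2 * l ^ 2 ∧
      (1 + c) * (1 / (1 + v) ^ 2 - 1 + 2 * l) - 2 * l ^ 2 ≤
        v ^ 2 * (2 + v) / (1 + v) ^ 2 * (c - v / 2) := by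
  have h3 : v * (2 + v) / (2 * (1 + v)) ≤ (1 + v) / 2 := by
    rw [div_le_div_iff₀ (by positivity) (by positivity)]; nlinarith
  constructor
  · set p := 2 * v / (2 + v) with hp
    have h4 : 0 ≤ (l - p) * (2 * (1 + c) - 2 * (l + p)) :=
      mul_nonneg (by linarith) (by linarith)
    have h5 : 1 / (1 + v) ^ 2 - 1 + 2 * p = v ^ 2 * (4 + 3 * v) / ((2 + v) * (1 + v) ^ 2) := by
      rw [hp]; field_simp; ring
    have h6 : 2 * p ^ 2 ≤ (1 + v) * (v ^ 2 * (4 + 3 * v) / ((2 + v) * (1 + v) ^ 2)) := by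
      have : (1 + v) * (v ^ 2 * (4 + 3 * v) / ((2 + v) * (1 + v) ^ 2)) - 2 * p ^ 2 =
          v ^ 3 * (2 + 3 * v) / ((2 + v) ^ 2 * (1 + v)) := by
        rw [hp]; field_simp; ring
      have h7 : 0 ≤ v ^ 3 * (2 + 3 * v) / ((2 + v) ^ 2 * (1 + v)) := by positivity
      linarith
    have h7 : (1 + v) * (1 / (1 + v) ^ 2 - 1 + 2 * p) ≤
        (1 + c) * (1 / (1 + v) ^ 2 - 1 + 2 * p) := by
      refine mul_le_mul_of_nonneg_right (by linarith) ?_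
      rw [h5]; positivity
    rw [← h5] at h6
    nlinarith
  · set p := v * (2 + v) / (2 * (1 + v)) with hp
    have h4 : 0 ≤ (p - l) * (2 * (1 + c) - 2 * (p + l)) :=
      mul_nonneg (by linarith) (by linarith)
    have h5 : v ^ 2 * (2 + v) / (1 + v) ^ 2 * (c - v / 2) =
        (1 + c) * (1 / (1 + v) ^ 2 - 1 + 2 * p) - 2 * p ^ 2 := by
      rw [hp]; field_simp; ring
    rw [h5]
    linarith

theorem hyperbola_main_bounds {N v l H L γ γ₁ m : ℝ} (hN : 1 ≤ N) (hv : 0 ≤ v) (hvN : v ≤ 1 / N)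
    (h1 : 2 * v / (2 + v) ≤ l) (h2 : l ≤ v * (2 + v) / (2 * (1 + v)))
    (h3 : H - m - 1 / (2 * N) ≤ γ) (h4 : γ ≤ H - m - 1 / (2 * N) + 1 / N ^ 2 / 12)
    (h5 : L - m ^ 2 / 2 - m / (2 * N) - m * (H - m - 1 / (2 * N)) - 1 / N ^ 2 / 8 ≤ γ₁ - m * γ)
    (h6 : γ₁ - m * γ ≤
      L - m ^ 2 / 2 - m / (2 * N) - m * (H - m - 1 / (2 * N)) + 1 / N ^ 2 / 24) :
    ∃ J, N + 2 * (N * (1 + v)) ^ 2 * ((2 * (m + l) + γ - 1) * H - L) -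
        (N * (1 + v)) ^ 2 * H ^ 2 + N ^ 2 =
      (N * (1 + v)) ^ 2 * ((2 * (m + l)) ^ 2 / 2 + 2 * γ * (2 * (m + l)) + γ ^ 2 - 2 * γ₁ -
        2 * (m + l) - 2 * γ + 1) + J ∧
      J ≤ 3 / 2 + 11 / 144 * (1 + v) ^ 2 ∧ -(7 / 12 * (1 + v) ^ 2) ≤ J := by
  obtain ⟨c, hc⟩ : ∃ c, c = 1 / N := ⟨_, rfl⟩
  have hN0 : 0 < N := by linarith
  have hNc : N * c = 1 := by rw [hc]; field_simp
  have hc0 : 0 < c := by rw [hc]; positivity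
  have hc1 : c ≤ 1 := by rw [hc, div_le_one hN0]; exact hN
  have e1 : 1 / (2 * N) = c / 2 := by rw [hc]; field_simp
  have e2 : 1 / N ^ 2 = c ^ 2 := by rw [hc]; field_simp
  have e3 : m / (2 * N) = m * c / 2 := by rw [hc]; field_simp
  rw [← hc] at hvN
  rw [e1] at h3 h4 h5 h6
  rw [e2] at h4 h5 h6
  rw [e3] at h5 h6
  obtain ⟨P, hP⟩ : ∃ P, P = (1 + c) * (1 / (1 + v) ^ 2 - 1 + 2 * l) - 2 * l ^ 2 := ⟨_, rfl⟩
  obtain ⟨hP0, hP1⟩ := hyperbola_error_bounds hv hvN h1 h2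
  rw [← hP] at hP0 hP1
  obtain ⟨η, hη⟩ : ∃ η, η = c / 2 - (H - m - γ) := ⟨_, rfl⟩
  obtain ⟨Z, hZ⟩ : ∃ Z, Z = γ₁ - m * γ - (L - m ^ 2 / 2 - m * c / 2 - m * (H - m - c / 2)) :=
    ⟨_, rfl⟩
  have hη0 : 0 ≤ η := by linarith
  have hη1 : η ≤ c ^ 2 / 12 := by linarith
  have hcc : c ^ 2 ≤ c := by rw [pow_two]; exact mul_le_of_le_one_left hc0.le hc1
  have hl0 : 0 ≤ l := le_trans (by positivity) h1
  have hl1 : l ≤ 3 / 4 := by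
    refine h2.trans ?_
    rw [div_le_div_iff₀ (by positivity) (by positivity)]; nlinarith
  have hs : 0 < (1 + v) ^ 2 := by positivity
  have hNP : (N * (1 + v)) ^ 2 * P ≤ 3 / 2 := by
    refine (mul_le_mul_of_nonneg_left hP1 (by positivity)).trans ?_
    have e4 : (N * (1 + v)) ^ 2 * (v ^ 2 * (2 + v) / (1 + v) ^ 2 * (c - v / 2)) =
        (N * v) ^ 2 * (2 + v) * (c - v / 2) := by field_simp
    rw [e4]
    obtain ⟨r, hr⟩ : ∃ r, r = N * v := ⟨_, rfl⟩
    have hvr : v = r * c := by rw [hr]; linear_combination -v * hNc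
    have hr0 : 0 ≤ r := by rw [hr]; positivity
    have hr1 : r ≤ 1 := by
      rw [hr, ← hNc]; exact mul_le_mul_of_nonneg_left hvN hN0.le
    rw [← hr, hvr]
    have e5 : r ^ 2 * (2 + r * c) * (c - r * c / 2) = c * (r ^ 2 * (2 + r * c) * (1 - r / 2)) := by
      ring
    rw [e5]
    have e6 : r ^ 2 * (2 + r * c) * (1 - r / 2) ≤ r ^ 2 * (2 + r) * (1 - r / 2) := by
      gcongr
      · linarith
      · nlinarith
    have e7 : r ^ 2 * (2 + r) * (1 - r / 2) ≤ 3 / 2 := by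
      have hr2 : r ^ 2 ≤ 1 := pow_le_one₀ hr0 hr1
      have := mul_nonneg (sub_nonneg.2 hr2) (show 0 ≤ 3 - r ^ 2 by linarith)
      linarith
    have e8 : 0 ≤ r ^ 2 * (2 + r * c) * (1 - r / 2) :=
      mul_nonneg (by positivity) (by linarith)
    exact (mul_le_of_le_one_left e8 hc1).trans (e6.trans e7)
  have hS : (N * (1 + v)) ^ 2 * c ^ 2 = (1 + v) ^ 2 := by
    have : (N * (1 + v)) ^ 2 * c ^ 2 = (N * c) ^ 2 * (1 + v) ^ 2 := by ring
    rw [this, hNc]; ring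
  have hK : 0 ≤ (N * (1 + v)) ^ 2 := by positivity
  refine ⟨(N * (1 + v)) ^ 2 * (2 * Z + P + (2 * η - (c / 2 - η) ^ 2 - 4 * η * l)), ?_, ?_, ?_⟩
  · have e9 : (N * (1 + v)) ^ 2 * P = (1 + c) * N ^ 2 - (N * (1 + v)) ^ 2 * ((1 + c) *
        (1 - 2 * l) + 2 * l ^ 2) := by rw [hP]; field_simp; ring
    have e10 : (1 + c) * N ^ 2 = N ^ 2 + N := by linear_combination N * hNc
    rw [hη, hZ]
    linear_combination -e9 - e10
  · have : 2 * Z + (2 * η - (c / 2 - η) ^ 2 - 4 * η * l) ≤ 11 / 144 * c ^ 2 := by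
      have a1 : 0 ≤ η * l := by positivity
      have a2 : 5 / 12 * c ≤ c / 2 - η := by linarith
      have a3 : (5 / 12 * c) ^ 2 ≤ (c / 2 - η) ^ 2 := by gcongr
      linarith
    have a4 := mul_le_mul_of_nonneg_left this hK
    linarith
  · have : -(7 / 12 * c ^ 2) ≤ 2 * Z + (2 * η - (c / 2 - η) ^ 2 - 4 * η * l) := by
      have a1 : η * l ≤ η * (3 / 4) := by gcongr
      have a2 : (c / 2 - η) ^ 2 ≤ (c / 2) ^ 2 := by
        have : 0 ≤ c / 2 - η := by linarith
        gcongr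
        linarith
      linarith
    have a4 := mul_le_mul_of_nonneg_left this hK
    have a5 := mul_nonneg hK hP0
    linarith

theorem sum_dk_two_mul_div_sub_one_eq (B : ℝ) (hB : 0 ≤ B) :
    ∑ b ∈ Icc 1 ⌊B⌋₊, (dk 2 b : ℝ) * (B / b - 1) =
      2 * ∑ a ∈ Icc 1 ⌊√B⌋₊, (B / a * harmonicSum ⌊B / a⌋₊ - ⌊B / a⌋₊) -
        (B * harmonicSum ⌊√B⌋₊ ^ 2 - (⌊√B⌋₊ : ℝ) ^ 2) := by
  rw [sum_dk_two_mul_eq (fun b => B / b - 1), floor_sqrt_eq hB]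
  congr 2
  · refine sum_congr rfl fun a _ => ?_
    rw [Nat.floor_div_natCast, sum_sub_distrib, harmonicSum, mul_sum]
    simp [div_eq_mul_inv, mul_assoc, mul_comm]
  · rw [harmonicSum, pow_two, sum_mul_sum, mul_sum]
    simp [sum_sub_distrib, mul_sum, div_eq_mul_inv, mul_comm, pow_two]

theorem abs_sum_dk_two_mul_div_sub_one_sub_le {γ₁ : ℝ}
    (hγ₁ : Tendsto (fun N : ℕ => logHarmonicSum N - (log N) ^ 2 / 2) atTop (nhds γ₁))
    {B : ℝ} (hB : 1 ≤ B) :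
    |∑ b ∈ Icc 1 ⌊B⌋₊, (dk 2 b : ℝ) * (B / b - 1) -
      B * ((log B) ^ 2 / 2 + 2 * eulerMascheroniConstant * log B + eulerMascheroniConstant ^ 2 -
        2 * γ₁ - log B - 2 * eulerMascheroniConstant + 1)| ≤ 5 / 2 := by
  have hB0 : 0 < B := by linarith
  have hu : 1 ≤ √B := one_le_sqrt.2 hB
  have hu2 : √B ^ 2 = B := sq_sqrt hB0.le
  have hN : 1 ≤ ⌊√B⌋₊ := Nat.one_le_floor_iff _ |>.2 hu
  have hN' : (1 : ℝ) ≤ ⌊√B⌋₊ := by exact_mod_cast hN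
  have hle : (⌊√B⌋₊ : ℝ) ≤ √B := Nat.floor_le (by linarith)
  have hlt : √B < ⌊√B⌋₊ + 1 := Nat.lt_floor_add_one _
  have hlog : log B = 2 * log √B := by rw [log_sqrt hB0.le]; ring
  rw [sum_dk_two_mul_div_sub_one_eq B hB0.le]
  set M := ⌊√B⌋₊ with hM
  obtain ⟨R, hR⟩ : ∃ R : ℕ → ℝ, R = fun a : ℕ => B / a * (harmonicSum ⌊B / a⌋₊ - log (B / a) -
    eulerMascheroniConstant + 1) - ⌊B / a⌋₊ - 1 / 2 := ⟨_, rfl⟩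
  have hRle : |∑ a ∈ Icc 1 M, R a| ≤ M * (M + 1) / 2 / (3 * B) := by
    have e1 : ∑ a ∈ Icc 1 M, (a : ℝ) / (3 * B) = M * (M + 1) / 2 / (3 * B) := by
      rw [← sum_div]
      congr 1
      clear_value M
      clear * -
      induction M with
      | zero => simp
      | succ k ih => rw [sum_Icc_succ_top (by omega), ih]; push_cast; ring
    rw [← e1]
    refine (abs_sum_le_sum_abs _ _).trans (sum_le_sum fun a ha => ?_)
    have ha' := mem_Icc.1 ha
    have ha0 : (1 : ℝ) ≤ a := by exact_mod_cast ha'.1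
    have haM : (a : ℝ) ≤ M := by exact_mod_cast ha'.2
    have h : 1 ≤ B / a := by rw [le_div_iff₀ (by linarith)]; nlinarith
    rw [hR]
    refine (abs_harmonicSum_floor_le h).trans_eq ?_
    field_simp
  have hsum : ∑ a ∈ Icc 1 M, (B / a * harmonicSum ⌊B / a⌋₊ - ⌊B / a⌋₊) =
      ∑ a ∈ Icc 1 M, R a + M / 2 + B * ((log B + eulerMascheroniConstant - 1) * harmonicSum M -
        logHarmonicSum M) := by
    have e1 : (M : ℝ) / 2 = ∑ a ∈ Icc 1 M, (1 / 2 : ℝ) := by simp; ring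
    rw [e1, harmonicSum, logHarmonicSum, mul_sum, ← sum_sub_distrib, mul_sum, ← sum_add_distrib,
      ← sum_add_distrib]
    refine sum_congr rfl fun a ha => ?_
    have ha0 : (a : ℝ) ≠ 0 := by
      have := (mem_Icc.1 ha).1
      exact_mod_cast (by omega : a ≠ 0)
    rw [hR]
    simp only [log_div hB0.ne' ha0]
    field_simp
    ring
  rw [hsum]
  have h3 := harmonicSum_le_of_pos hN
  have h4 := le_harmonicSum_of_pos hN
  have h5 := shiftedSeq_log_le hγ₁ hN
  have h6 := le_shiftedSeq_log hγ₁ hN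
  rw [shiftedSeq] at h5 h6
  have hM0 : (0 : ℝ) < M := by linarith
  obtain ⟨v, hv⟩ : ∃ v, v = √B / M - 1 := ⟨_, rfl⟩
  have hs : √B = M * (1 + v) := by rw [hv]; field_simp; ring
  have hv0 : 0 ≤ v := by rw [hv, sub_nonneg, le_div_iff₀ hM0]; linarith
  have hvN : v ≤ 1 / M := by
    rw [le_div_iff₀ hM0]; nlinarith
  have hl : log √B = log M + log (1 + v) := by
    rw [hs, log_mul hM0.ne' (by linarith)]
  have k1 := two_mul_div_le_log (s := 1 + v) (by linarith)
  have k2 := log_le_half_sub_inv (s := 1 + v) (by linarith)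
  have k1' : 2 * v / (2 + v) ≤ log (1 + v) := by
    convert k1 using 2 <;> ring
  have k2' : log (1 + v) ≤ v * (2 + v) / (2 * (1 + v)) := by
    refine k2.trans_eq ?_
    field_simp; ring
  obtain ⟨J, hJ, hJ1, hJ2⟩ := hyperbola_main_bounds hN' hv0 hvN k1' k2' h3 h4 h5 h6
  rw [← hl, ← hlog, ← hs, hu2] at hJ
  have hBs : B = M ^ 2 * (1 + v) ^ 2 := by rw [← hu2, hs]; ring
  have hv1 : v ≤ 1 := by
    refine hvN.trans ?_
    rw [div_le_one hM0]; exact hN'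
  have hE : 2 * (M * (M + 1) / 2 / (3 * B)) ≤ 2 / 3 / (1 + v) ^ 2 := by
    rw [hBs, div_div, ← mul_div_assoc, div_le_div_iff₀ (by positivity) (by positivity)]
    have : 0 ≤ (M : ℝ) * (M - 1) * (1 + v) ^ 2 :=
      mul_nonneg (mul_nonneg hM0.le (by linarith)) (by positivity)
    nlinarith
  have hR2 := abs_le.1 hRle
  have key : 2 / 3 / (1 + v) ^ 2 + 7 / 12 * (1 + v) ^ 2 ≤ 5 / 2 ∧
      2 / 3 / (1 + v) ^ 2 + (3 / 2 + 11 / 144 * (1 + v) ^ 2) ≤ 5 / 2 := by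
    have hS1 : 1 ≤ (1 + v) ^ 2 := one_le_pow₀ (by linarith)
    have hS4 : (1 + v) ^ 2 ≤ 2 ^ 2 := by
      gcongr
      linarith
    generalize (1 + v) ^ 2 = S at *
    have hS0 : 0 < S := by linarith
    have : 2 / 3 / S ≤ 5 / 6 - S / 6 := by
      rw [div_le_iff₀ hS0]
      have := mul_nonneg (sub_nonneg.2 hS1) (sub_nonneg.2 hS4)
      linarith
    constructor <;> linarith
  rw [abs_le]
  constructor <;> linarith [key.1, key.2]

theorem Tk_three_eq {x : ℝ} {A : ℕ} (hA : 1 ≤ A) (hAx : A ≤ ⌊x⌋₊) :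
    Tk 3 x = ∑ a ∈ Icc 1 A, Tk 2 (x / a) +
      ∑ b ∈ Icc 1 ⌊x / A⌋₊, (dk 2 b : ℝ) * (⌊x / b⌋₊ - A) := by
  have h1 : ⌊x⌋₊ < (A + 1) * (⌊x⌋₊ / A + 1) :=
    (Nat.lt_mul_div_succ _ hA).trans_le (Nat.mul_le_mul_right _ (Nat.le_succ A))
  rw [Tk]
  simp only [dk_three_eq_sum]
  rw [sum_Icc_sum_divisorsAntidiagonal (fun _ b => (dk 2 b : ℝ)), sum_sum_Icc_div_eq _ hAx h1]
  congr 1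
  · simp only [Tk, Nat.floor_div_natCast]
  · rw [Nat.floor_div_natCast]
    refine sum_congr rfl fun b hb => ?_
    obtain ⟨hb1, hb2⟩ := mem_Icc.1 hb
    rw [Nat.le_div_iff_mul_le hA, mul_comm, ← Nat.le_div_iff_mul_le hb1] at hb2
    rw [sum_const, Nat.card_Icc, Nat.add_sub_add_right, nsmul_eq_mul, Nat.cast_sub hb2,
      Nat.floor_div_natCast, mul_comm]

theorem sum_div_mul_log_eq {x : ℝ} (hx : 0 < x) (k : ℝ) (A : ℕ) :
    ∑ a ∈ Icc 1 A, x / a * (log (x / a) + k) =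
      x * ((log x + k) * harmonicSum A - logHarmonicSum A) := by
  rw [harmonicSum, logHarmonicSum, mul_sum, ← sum_sub_distrib, mul_sum]
  refine sum_congr rfl fun a ha => ?_
  have ha0 : (a : ℝ) ≠ 0 := by
    have := (mem_Icc.1 ha).1
    exact_mod_cast (by omega : a ≠ 0)
  rw [log_div hx.ne' ha0]
  field_simp
  ring

theorem sum_Tk_two_sub_abs_le {x : ℝ} {A : ℕ} (hAx : (A : ℝ) ≤ x) :
    |∑ a ∈ Icc 1 A, Tk 2 (x / a) -
      ∑ a ∈ Icc 1 A, x / a * (log (x / a) + (2 * eulerMascheroniConstant - 1))| ≤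
        √x * ∑ a ∈ Icc 1 A, 1 / √(a : ℝ) + 2 / 3 * A := by
  have hx : 0 ≤ x := le_trans (Nat.cast_nonneg A) hAx
  have e1 : √x * ∑ a ∈ Icc 1 A, 1 / √(a : ℝ) + 2 / 3 * A =
      ∑ a ∈ Icc 1 A, (√(x / a) + 2 / 3) := by
    rw [sum_add_distrib, mul_sum]
    simp only [sqrt_div hx, mul_one_div, sum_const, Nat.card_Icc, nsmul_eq_mul,
      Nat.add_sub_cancel]
    ring
  rw [e1, ← sum_sub_distrib]
  refine (abs_sum_le_sum_abs _ _).trans (sum_le_sum fun a ha => ?_)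
  obtain ⟨ha1, ha2⟩ := mem_Icc.1 ha
  have ha0 : (1 : ℝ) ≤ a := by exact_mod_cast ha1
  have haA : (a : ℝ) ≤ A := by exact_mod_cast ha2
  have h := abs_Tk_two_sub_le (y := x / a) (by rw [le_div_iff₀ (by linarith)]; linarith)
  rwa [add_sub_assoc] at h

theorem sum_dk_two_mul_floor_bounds {x : ℝ} {A : ℕ} (hA : 1 ≤ A) (hx : 0 ≤ x) :
    ∑ b ∈ Icc 1 ⌊x / A⌋₊, (dk 2 b : ℝ) * (⌊x / b⌋₊ - A) ≤
        A * ∑ b ∈ Icc 1 ⌊x / A⌋₊, (dk 2 b : ℝ) * (x / A / b - 1) ∧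
      A * ∑ b ∈ Icc 1 ⌊x / A⌋₊, (dk 2 b : ℝ) * (x / A / b - 1) - Tk 2 (x / A) ≤
        ∑ b ∈ Icc 1 ⌊x / A⌋₊, (dk 2 b : ℝ) * (⌊x / b⌋₊ - A) := by
  have hA0 : (A : ℝ) ≠ 0 := by exact_mod_cast (by omega : A ≠ 0)
  have e (b : ℕ) : (A : ℝ) * ((dk 2 b : ℝ) * (x / A / b - 1)) = dk 2 b * (x / b - A) := by
    field_simp
  rw [mul_sum]
  simp only [e]
  constructor
  · refine sum_le_sum fun b _ => ?_
    gcongr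
    exact Nat.floor_le (by positivity)
  · rw [Tk, ← sum_sub_distrib]
    refine sum_le_sum fun b _ => ?_
    have h := (Nat.sub_one_lt_floor (x / (b : ℝ))).le
    have h2 := mul_le_mul_of_nonneg_left h (Nat.cast_nonneg (α := ℝ) (dk 2 b))
    linarith

theorem abs_Tk_three_sub_le {γ₁ : ℝ}
    (hγ₁ : Tendsto (fun N : ℕ => logHarmonicSum N - (log N) ^ 2 / 2) atTop (nhds γ₁))
    {x : ℝ} {A : ℕ} (hA : 1 ≤ A) (hAx : (A : ℝ) ≤ x) :
    |Tk 3 x - x * ((log x) ^ 2 / 2 + (3 * eulerMascheroniConstant - 1) * log x +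
        3 * eulerMascheroniConstant ^ 2 - 3 * eulerMascheroniConstant - 3 * γ₁ + 1)| ≤
      x / A * (log (x / A) + 2 * eulerMascheroniConstant - 1) / 2 + √(x / A) + 2 / 3 +
        √x * ∑ a ∈ Icc 1 A, 1 / √(a : ℝ) + 19 / 6 * A +
        x / A / A * (1 / 8 + (log (x / A) + 2 * eulerMascheroniConstant - 1) / 12) := by
  have hA1 : (1 : ℝ) ≤ A := by exact_mod_cast hA
  have hA0 : (0 : ℝ) < A := by linarith
  have hx0 : 0 < x := by linarith
  have hB1 : 1 ≤ x / A := by rw [le_div_iff₀ hA0]; linarith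
  have hlog : log x = log A + log (x / A) := by
    rw [log_div hx0.ne' hA0.ne']; ring
  have h1 := sum_Tk_two_sub_abs_le hAx
  have h2 := sum_dk_two_mul_floor_bounds hA hx0.le
  have h3 := abs_sum_dk_two_mul_div_sub_one_sub_le hγ₁ hB1
  have h4 := abs_Tk_two_sub_le hB1
  have h5 := harmonicSum_le_of_pos hA
  have h6 := le_harmonicSum_of_pos hA
  have h7 := shiftedSeq_log_le hγ₁ hA
  have h8 := le_shiftedSeq_log hγ₁ hA
  have h9 := one_half_lt_eulerMascheroniConstant
  have hb0 := log_nonneg hB1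
  rw [shiftedSeq] at h7 h8
  rw [sum_div_mul_log_eq hx0] at h1
  rw [Tk_three_eq hA (Nat.le_floor hAx)]
  rw [hlog] at h1 ⊢
  generalize ∑ b ∈ Icc 1 ⌊x / A⌋₊, (dk 2 b : ℝ) * (⌊x / b⌋₊ - A) = S at *
  generalize ∑ b ∈ Icc 1 ⌊x / A⌋₊, (dk 2 b : ℝ) * (x / A / b - 1) = W at *
  generalize ∑ a ∈ Icc 1 A, Tk 2 (x / a) = T at *
  generalize Tk 2 (x / A) = T' at *
  generalize √x * ∑ a ∈ Icc 1 A, 1 / √(a : ℝ) = Q at *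
  generalize √(x / A) = Q' at *
  generalize harmonicSum A = H at *
  generalize logHarmonicSum A = L at *
  generalize eulerMascheroniConstant = γ at *
  generalize log (x / A) = b at *
  generalize log (A : ℝ) = a at *
  clear hlog hγ₁
  obtain ⟨B, hB⟩ : ∃ B, B = x / A := ⟨_, rfl⟩
  rw [← hB] at hB1 h3 h4 ⊢
  have hxB : x = B * A := by rw [hB]; field_simp
  obtain ⟨c, hc⟩ : ∃ c, c = 1 / (A : ℝ) := ⟨_, rfl⟩
  have e1 : 1 / (2 * (A : ℝ)) = c / 2 := by rw [hc]; field_simp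
  have e2 : 1 / (A : ℝ) ^ 2 = c ^ 2 := by rw [hc]; field_simp
  have e3 : a / (2 * (A : ℝ)) = a * c / 2 := by rw [hc]; field_simp
  have e4 : B / A = x * c ^ 2 := by rw [hc, hxB]; field_simp
  have e5 : x * c = B := by rw [hc, hB]; field_simp
  rw [e1] at h5 h6 h7 h8
  rw [e2] at h6 h7 h8
  rw [e3] at h7 h8
  rw [e4]
  have h3' := abs_le.1 h3
  have h3l := mul_le_mul_of_nonneg_left h3'.1 hA0.le
  have h3u := mul_le_mul_of_nonneg_left h3'.2 hA0.le
  rw [mul_sub, ← mul_assoc, mul_comm (A : ℝ) B, ← hxB] at h3l h3u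
  obtain ⟨η, hη⟩ : ∃ η, η = c / 2 - (H - a - γ) := ⟨_, rfl⟩
  obtain ⟨Z, hZ⟩ : ∃ Z, Z = γ₁ - a * γ - (L - a ^ 2 / 2 - a * c / 2 - a * (H - a - c / 2)) :=
    ⟨_, rfl⟩
  have key : x * ((a + b + (2 * γ - 1)) * H - L) + x * (b ^ 2 / 2 + 2 * γ * b + γ ^ 2 - 2 * γ₁ -
      b - 2 * γ + 1) - x * ((a + b) ^ 2 / 2 + (3 * γ - 1) * (a + b) + 3 * γ ^ 2 - 3 * γ -
      3 * γ₁ + 1) = B * (b + 2 * γ - 1) / 2 + x * (Z - (b + 2 * γ - 1) * η) := by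
    rw [hη, hZ, ← e5]
    ring
  have hη0 : 0 ≤ (b + 2 * γ - 1) * η := mul_nonneg (by linarith) (by linarith)
  have hη1 : (b + 2 * γ - 1) * η ≤ (b + 2 * γ - 1) * (c ^ 2 / 12) :=
    mul_le_mul_of_nonneg_left (by linarith) (by linarith)
  have hη2 : 0 ≤ (b + 2 * γ - 1) * (c ^ 2 / 12) := mul_nonneg (by linarith) (by positivity)
  have ku : x * (Z - (b + 2 * γ - 1) * η) ≤
      x * (c ^ 2 * (1 / 8 + (b + 2 * γ - 1) / 12)) := by
    refine mul_le_mul_of_nonneg_left ?_ hx0.le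
    have := sq_nonneg c
    linarith
  have kl : x * (-(c ^ 2 * (1 / 8 + (b + 2 * γ - 1) / 12))) ≤
      x * (Z - (b + 2 * γ - 1) * η) := by
    refine mul_le_mul_of_nonneg_left ?_ hx0.le
    have := sq_nonneg c
    linarith
  have h1' := abs_le.1 h1
  have h4' := abs_le.1 h4
  have hQ' : 0 ≤ Q' + 2 / 3 := (abs_nonneg _).trans h4
  have hM : 0 ≤ B * (b + 2 * γ - 1) := mul_nonneg (by linarith) (by linarith)
  rw [abs_le]
  constructor <;> linarith

theorem sum_one_div_sqrt_le {n : ℕ} (hn : 1 ≤ n) :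
    ∑ a ∈ Icc 1 n, 1 / √(a : ℝ) ≤ 2 * √n - 1 := by
  induction n, hn using Nat.le_induction with
  | base => norm_num
  | succ m hm ih =>
    rw [sum_Icc_succ_top (by omega)]
    have h1 : √(m : ℝ) ≤ √((m + 1 : ℕ) : ℝ) := sqrt_le_sqrt (by push_cast; linarith)
    have h2 : √((m + 1 : ℕ) : ℝ) ^ 2 = m + 1 := by rw [sq_sqrt (by positivity)]; push_cast; ring
    have h3 : √(m : ℝ) ^ 2 = m := sq_sqrt (by positivity)
    have h4 : 0 < √((m + 1 : ℕ) : ℝ) := sqrt_pos.2 (by positivity)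
    have h5 : 1 / √((m + 1 : ℕ) : ℝ) ≤ 2 * √((m + 1 : ℕ) : ℝ) - 2 * √(m : ℝ) := by
      rw [div_le_iff₀ h4]
      nlinarith [sq_nonneg (√((m + 1 : ℕ) : ℝ) - √(m : ℝ))]
    linarith

theorem eulerMascheroniConstant_le_seven_div_twelve : eulerMascheroniConstant ≤ 7 / 12 := by
  have := le_harmonicSum_of_pos le_rfl
  norm_num [harmonicSum] at this
  linarith

theorem log_le_div_eight {x : ℝ} (hx : 27 ≤ x) : log x ≤ x / 8 := by
  have h1 : log x = 3 * log 3 + log (x / 27) := by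
    rw [log_div (by linarith) (by norm_num), show (27 : ℝ) = 3 ^ 3 by norm_num, log_pow]
    push_cast; ring
  have h2 := log_le_sub_one_of_pos (show 0 < x / 27 by linarith)
  have h3 := log_three_lt_d9
  linarith

/-- The choice of the splitting parameter `z = 9/16 * q * k ^ 2` with `q = x ^ (1/3)` and
`k = (log x) ^ (1/3)` bounds the logarithmic factor. -/
theorem log_div_add_le {x q k : ℝ} (hx : 27 ≤ x) (hq : 0 < q) (hk : 0 < k) (hqx : q ^ 3 = x)
    (hkx : k ^ 3 = log x) :
    log (x / (9 / 16 * q * k ^ 2)) + 2 * eulerMascheroniConstant - 1 ≤ 2 / 3 * log x := by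
  have h2 := log_two_lt_d9
  have h3 := log_three_gt_d9
  have hγ := eulerMascheroniConstant_le_seven_div_twelve
  have hL : 3.29 ≤ log x := by
    have := log_le_log (by norm_num) hx
    rw [show (27 : ℝ) = 3 ^ 3 by norm_num, log_pow] at this
    push_cast at this
    linarith
  have hLL : 1.18 ≤ log (log x) := by
    have e1 := log_le_log (by norm_num) hL
    have e2 := one_sub_inv_le_log_of_pos (show (0 : ℝ) < 3.29 / 3 by norm_num)
    rw [log_div (by norm_num) (by norm_num)] at e2
    norm_num at e1 e2 ⊢
    linarith
  have e1 : log x = 3 * log q := by rw [← hqx, log_pow]; push_cast; ring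
  have e2 : log (log x) = 3 * log k := by rw [← hkx, log_pow]; push_cast; ring
  have e3 : log (9 / 16) = 2 * log 3 - 4 * log 2 := by
    rw [show (9 / 16 : ℝ) = 3 ^ 2 / 2 ^ 4 by norm_num, log_div (by norm_num) (by norm_num),
      log_pow, log_pow]
    push_cast; ring
  rw [log_div (by linarith) (by positivity), log_mul (by positivity) (by positivity),
    log_mul (by norm_num) hq.ne', log_pow, e3]
  push_cast
  linarith

theorem abs_Tk_three_sub_le_of_large {γ₁ : ℝ}
    (hγ₁ : Tendsto (fun N : ℕ => logHarmonicSum N - (log N) ^ 2 / 2) atTop (nhds γ₁))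
    {x q k : ℝ} (hx : 27 ≤ x) (hq : 0 < q) (hk : 0 < k) (hqx : q ^ 3 = x) (hkx : k ^ 3 = log x) :
    |Tk 3 x - x * ((log x) ^ 2 / 2 + (3 * eulerMascheroniConstant - 1) * log x +
        3 * eulerMascheroniConstant ^ 2 - 3 * eulerMascheroniConstant - 3 * γ₁ + 1)| ≤
      3.369 * q ^ 2 * k := by
  have hx0 : 0 < x := by linarith
  have hL : 3.29 ≤ log x := by
    have h3 := log_three_gt_d9
    have := log_le_log (by norm_num) hx
    rw [show (27 : ℝ) = 3 ^ 3 by norm_num, log_pow] at this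
    push_cast at this
    linarith
  have hq3 : 3 ≤ q := by
    refine le_of_pow_le_pow_left₀ (n := 3) (by norm_num) hq.le ?_
    rw [hqx]; linarith
  have hk1 : 1.48 ≤ k := by
    refine le_of_pow_le_pow_left₀ (n := 3) (by norm_num) hk.le ?_
    rw [hkx]; norm_num at hL ⊢; linarith
  have hkq : k ≤ q / 2 := by
    refine le_of_pow_le_pow_left₀ (n := 3) (by norm_num) (by linarith) ?_
    have := log_le_div_eight hx
    rw [div_pow, hkx, hqx]; norm_num; linarith
  have hlogz := log_div_add_le hx hq hk hqx hkx
  obtain ⟨z, hz⟩ : ∃ z, z = 9 / 16 * q * k ^ 2 := ⟨_, rfl⟩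
  rw [← hz] at hlogz
  have hk2 : 1.48 ^ 2 ≤ k ^ 2 := by gcongr
  have hz3 : 3 < z := by
    have : 3 * 1.48 ^ 2 ≤ q * k ^ 2 := by gcongr
    rw [hz]; norm_num at this ⊢; linarith
  have hz0 : 0 < z := by linarith
  have hqk : q * k ^ 2 ≤ q ^ 2 * k / 2 := by
    have := mul_le_mul_of_nonneg_left hkq (mul_pos hq hk).le
    linarith
  have hA4 : 4 ≤ ⌈z⌉₊ := Nat.succ_le_iff.2 (Nat.lt_ceil.2 (by exact_mod_cast hz3))
  have hzA : z ≤ ⌈z⌉₊ := Nat.le_ceil z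
  have hAz : (⌈z⌉₊ : ℝ) < z + 1 := Nat.ceil_lt_add_one hz0.le
  have hzx : z + 1 ≤ x := by
    have h1 : k ^ 2 ≤ (q / 2) ^ 2 := by gcongr
    have h2 := mul_le_mul_of_nonneg_left h1 hq.le
    have h3 : q * (q / 2) ^ 2 = x / 4 := by rw [← hqx]; ring
    rw [hz]; linarith
  have hmain := abs_Tk_three_sub_le hγ₁ (x := x) (A := ⌈z⌉₊) (by omega) (by linarith)
  have hAA : (4 : ℝ) ≤ ⌈z⌉₊ := by exact_mod_cast hA4
  have hS : √(x / ⌈z⌉₊) + √x * ∑ a ∈ Icc 1 ⌈z⌉₊, 1 / √(a : ℝ) ≤ 3 / 2 * (q ^ 2 * k) := by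
    obtain ⟨m, hm⟩ : ∃ m, ⌈z⌉₊ = m + 1 := ⟨⌈z⌉₊ - 1, by omega⟩
    have h1 : √x * √z = 3 / 4 * (q ^ 2 * k) := by
      rw [← sqrt_mul hx0.le, ← hqx, hz,
        show q ^ 3 * (9 / 16 * q * k ^ 2) = (3 / 4 * (q ^ 2 * k)) ^ 2 by ring,
        sqrt_sq (by positivity)]
    rw [sqrt_div hx0.le, hm, sum_Icc_succ_top (by omega)]
    have h2 := sum_one_div_sqrt_le (n := m) (by omega)
    rw [hm] at hAz hAA
    have h3 : √(m : ℝ) ≤ √z := sqrt_le_sqrt (by push_cast at hAz; linarith)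
    have h4 : 1 / √((m + 1 : ℕ) : ℝ) ≤ 1 / 2 := by
      gcongr
      rw [le_sqrt (by norm_num) (by positivity)]
      norm_num at hAA ⊢; linarith
    have h5 := mul_le_mul_of_nonneg_left (show ∑ a ∈ Icc 1 m, 1 / √(a : ℝ) +
      1 / √((m + 1 : ℕ) : ℝ) + 1 / √((m + 1 : ℕ) : ℝ) ≤ 2 * √z by linarith) (sqrt_nonneg x)
    have h6 : √x / √((m + 1 : ℕ) : ℝ) = √x * (1 / √((m + 1 : ℕ) : ℝ)) := by ring
    rw [h6]
    linarith
  have hBz : x / ⌈z⌉₊ ≤ x / z := by gcongr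
  have hB1 : 1 ≤ x / ⌈z⌉₊ := by rw [le_div_iff₀ (by linarith)]; linarith
  have hlogB : log (x / ⌈z⌉₊) + 2 * eulerMascheroniConstant - 1 ≤ 2 / 3 * log x := by
    have := log_le_log (by linarith) hBz
    linarith
  have hγ := one_half_lt_eulerMascheroniConstant
  have hB0 := log_nonneg hB1
  have hM : x / ⌈z⌉₊ * (log (x / ⌈z⌉₊) + 2 * eulerMascheroniConstant - 1) / 2 ≤
      16 / 27 * (q ^ 2 * k) := by
    have h1 := mul_le_mul hBz hlogB (by linarith) (by positivity)
    have h2 : x / z * (2 / 3 * log x) = 32 / 27 * (q ^ 2 * k) := by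
      rw [hz, ← hkx, ← hqx]; field_simp; norm_num
    linarith
  have hlast : x / ⌈z⌉₊ / ⌈z⌉₊ *
      (1 / 8 + (log (x / ⌈z⌉₊) + 2 * eulerMascheroniConstant - 1) / 12) ≤ 21 / 100 * q := by
    have h1 : x / ⌈z⌉₊ / ⌈z⌉₊ ≤ x / z / z := by gcongr
    have h2 := mul_le_mul h1 (show 1 / 8 + (log (x / ⌈z⌉₊) + 2 * eulerMascheroniConstant - 1) / 12 ≤
      1 / 8 + log x / 18 by linarith) (by linarith) (by positivity)
    have h3 : x / z / z * (1 / 8 + log x / 18) =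
        256 / 81 * q * (1 / 8 * (1 / k) ^ 4 + 1 / 18 * (1 / k)) := by
      rw [hz, ← hkx, ← hqx]; field_simp; ring
    have h4 : 1 / k ≤ 0.676 := by
      rw [div_le_iff₀ hk]; norm_num at hk1 ⊢; linarith
    have h5 : 1 / 8 * (1 / k) ^ 4 + 1 / 18 * (1 / k) ≤ 8 / 125 := by
      have : 1 / 8 * (1 / k) ^ 4 + 1 / 18 * (1 / k) ≤ 1 / 8 * 0.676 ^ 4 + 1 / 18 * 0.676 := by
        gcongr
      exact this.trans (by norm_num)
    have h6 := mul_le_mul_of_nonneg_left h5 (show 0 ≤ 256 / 81 * q by positivity)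
    linarith
  have hq2k : 3 * 1.48 * q ≤ q ^ 2 * k := by
    have h1 : 3 * 1.48 ≤ q * k := by gcongr
    have := mul_le_mul_of_nonneg_left h1 hq.le
    linarith
  norm_num at hq2k ⊢
  linarith

theorem Tk_three_eq_sum_div (x : ℝ) :
    Tk 3 x = ∑ a ∈ Icc 1 ⌊x⌋₊, ∑ b ∈ Icc 1 (⌊x⌋₊ / a), ((⌊x⌋₊ / a / b : ℕ) : ℝ) := by
  rw [Tk]
  simp only [dk_three_eq_sum]
  rw [sum_Icc_sum_divisorsAntidiagonal (fun _ b => (dk 2 b : ℝ))]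
  refine sum_congr rfl fun a _ => ?_
  have := sum_dk_two_mul (fun _ => 1) (⌊x⌋₊ / a)
  simp only [mul_one] at this
  rw [this]
  simp

theorem abs_Tk_three_sub_le_of_floor_eq {γ₁ : ℝ}
    (hγ₁ : Tendsto (fun N : ℕ => logHarmonicSum N - (log N) ^ 2 / 2) atTop (nhds γ₁))
    {x q k : ℝ} (hx : 1 ≤ x) (hq : 0 < q) (hk : 0 < k) (hqx : q ^ 3 = x) (hkx : k ^ 3 = log x)
    {n T : ℕ} {l h p : ℝ} (hn : ⌊x⌋₊ = n)
    (hT : ∑ a ∈ Icc 1 n, ∑ b ∈ Icc 1 (n / a), n / a / b = T)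
    (hl0 : 0 ≤ l) (hl : l ≤ log n) (hh : log (n + 1) ≤ h) (hp : p ^ 3 ≤ n ^ 2 * l)
    (hlo : T - 3.369 * p ≤ n * (l ^ 2 / 2 + l / 2 + 1 / 8))
    (hhi : (n + 1) * (h ^ 2 / 2 + 3 / 4 * h + 31 / 48) ≤ T + 3.369 * p) :
    |Tk 3 x - x * ((log x) ^ 2 / 2 + (3 * eulerMascheroniConstant - 1) * log x +
        3 * eulerMascheroniConstant ^ 2 - 3 * eulerMascheroniConstant - 3 * γ₁ + 1)| ≤
      3.369 * q ^ 2 * k := by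
  have hn0 : (0 : ℝ) < n := by
    have := Nat.one_le_floor_iff x |>.2 hx
    exact_mod_cast hn ▸ this
  have hnx : (n : ℝ) ≤ x := hn ▸ Nat.floor_le (by linarith)
  have hxn : x ≤ n + 1 := hn ▸ (Nat.lt_floor_add_one x).le
  have hL1 : l ≤ log x := hl.trans (log_le_log hn0 hnx)
  have hL2 : log x ≤ h := (log_le_log (by linarith) hxn).trans hh
  have hTk : Tk 3 x = T := by rw [Tk_three_eq_sum_div, hn, ← hT]; push_cast; rfl
  have hpq : p ≤ q ^ 2 * k := by
    refine le_of_pow_le_pow_left₀ (n := 3) (by norm_num) (by positivity) (hp.trans ?_)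
    have : (q ^ 2 * k) ^ 3 = x ^ 2 * log x := by rw [← hkx, ← hqx]; ring
    rw [this]
    gcongr
  have hγ := one_half_lt_eulerMascheroniConstant
  have hγ' := eulerMascheroniConstant_le_seven_div_twelve
  have g1 := shiftedSeq_log_le hγ₁ le_rfl
  have g2 := le_shiftedSeq_log hγ₁ le_rfl
  norm_num [shiftedSeq, logHarmonicSum] at g1 g2
  rw [hTk]
  generalize eulerMascheroniConstant = γ at *
  generalize log x = L at *
  have hL0 : 0 ≤ L := hl0.trans hL1
  have q1 : l ^ 2 / 2 + l / 2 + 1 / 8 ≤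
      L ^ 2 / 2 + (3 * γ - 1) * L + 3 * γ ^ 2 - 3 * γ - 3 * γ₁ + 1 := by
    have a1 : l ^ 2 ≤ L ^ 2 := by gcongr
    have a2 : 1 / 2 * L ≤ (3 * γ - 1) * L := mul_le_mul_of_nonneg_right (by linarith) hL0
    have a3 := sq_nonneg (γ - 1 / 2)
    linarith
  have q2 : L ^ 2 / 2 + (3 * γ - 1) * L + 3 * γ ^ 2 - 3 * γ - 3 * γ₁ + 1 ≤
      h ^ 2 / 2 + 3 / 4 * h + 31 / 48 := by
    have a1 : L ^ 2 ≤ h ^ 2 := by gcongr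
    have a2 : (3 * γ - 1) * L ≤ 3 / 4 * L := mul_le_mul_of_nonneg_right (by linarith) hL0
    have a3 : 0 ≤ (7 / 12 - γ) * (γ - 5 / 12) := mul_nonneg (by linarith) (by linarith)
    linarith
  have r0 : 0 ≤ l ^ 2 / 2 + l / 2 + 1 / 8 := by positivity
  have r1 := mul_le_mul hnx q1 r0 (by linarith)
  have r2 := mul_le_mul hxn q2 (r0.trans q1) (by linarith)
  have r3 := mul_le_mul_of_nonneg_left hpq (show (0 : ℝ) ≤ 3.369 by norm_num)
  rw [abs_le]
  constructor <;> linarith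

theorem log_nat_mul {a b : ℕ} (ha : a ≠ 0) (hb : b ≠ 0) :
    log ((a * b : ℕ) : ℝ) = log a + log b := by
  push_cast
  exact log_mul (by exact_mod_cast ha) (by exact_mod_cast hb)

set_option maxHeartbeats 1000000 in
theorem abs_Tk_three_sub_le_of_small {γ₁ : ℝ}
    (hγ₁ : Tendsto (fun N : ℕ => logHarmonicSum N - (log N) ^ 2 / 2) atTop (nhds γ₁))
    {x q k : ℝ} (hx2 : 2 ≤ x) (hx : x < 27) (hq : 0 < q) (hk : 0 < k) (hqx : q ^ 3 = x)
    (hkx : k ^ 3 = log x) :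
    |Tk 3 x - x * ((log x) ^ 2 / 2 + (3 * eulerMascheroniConstant - 1) * log x +
        3 * eulerMascheroniConstant ^ 2 - 3 * eulerMascheroniConstant - 3 * γ₁ + 1)| ≤
      3.369 * q ^ 2 * k := by
  obtain ⟨n, hn⟩ : ∃ n, ⌊x⌋₊ = n := ⟨_, rfl⟩
  have hn2 : 2 ≤ n := hn ▸ Nat.le_floor (by exact_mod_cast hx2)
  have hn27 : n < 27 := hn ▸ (Nat.floor_lt (by linarith)).2 (by exact_mod_cast hx)
  have b2 := log_two_gt_d9
  have t2 := log_two_lt_d9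
  have b3 := log_three_gt_d9
  have t3 := log_three_lt_d9
  have e4 := log_nat_mul (a := 2) (b := 2) (by norm_num) (by norm_num)
  have e6 := log_nat_mul (a := 2) (b := 3) (by norm_num) (by norm_num)
  have e8 := log_nat_mul (a := 2) (b := 4) (by norm_num) (by norm_num)
  have e9 := log_nat_mul (a := 3) (b := 3) (by norm_num) (by norm_num)
  have e10 := log_nat_mul (a := 2) (b := 5) (by norm_num) (by norm_num)
  have e12 := log_nat_mul (a := 2) (b := 6) (by norm_num) (by norm_num)
  have e14 := log_nat_mul (a := 2) (b := 7) (by norm_num) (by norm_num)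
  have e15 := log_nat_mul (a := 3) (b := 5) (by norm_num) (by norm_num)
  have e16 := log_nat_mul (a := 2) (b := 8) (by norm_num) (by norm_num)
  have e18 := log_nat_mul (a := 2) (b := 9) (by norm_num) (by norm_num)
  have e20 := log_nat_mul (a := 2) (b := 10) (by norm_num) (by norm_num)
  have e21 := log_nat_mul (a := 3) (b := 7) (by norm_num) (by norm_num)
  have e22 := log_nat_mul (a := 2) (b := 11) (by norm_num) (by norm_num)
  have e24 := log_nat_mul (a := 2) (b := 12) (by norm_num) (by norm_num)
  have e25 := log_nat_mul (a := 5) (b := 5) (by norm_num) (by norm_num)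
  have e26 := log_nat_mul (a := 2) (b := 13) (by norm_num) (by norm_num)
  have e27 := log_nat_mul (a := 3) (b := 9) (by norm_num) (by norm_num)
  have b5 := le_log_succ_sub (n := 4) (by norm_num)
  have t5 := log_succ_sub_le (n := 4) (by norm_num)
  have b7 := le_log_succ_sub (n := 6) (by norm_num)
  have t7 := log_succ_sub_le (n := 6) (by norm_num)
  have b11 := le_log_succ_sub (n := 10) (by norm_num)
  have t11 := log_succ_sub_le (n := 10) (by norm_num)
  have b13 := le_log_succ_sub (n := 12) (by norm_num)
  have t13 := log_succ_sub_le (n := 12) (by norm_num)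
  have b17 := le_log_succ_sub (n := 16) (by norm_num)
  have t17 := log_succ_sub_le (n := 16) (by norm_num)
  have b19 := le_log_succ_sub (n := 18) (by norm_num)
  have t19 := log_succ_sub_le (n := 18) (by norm_num)
  have b23 := le_log_succ_sub (n := 22) (by norm_num)
  have t23 := log_succ_sub_le (n := 22) (by norm_num)
  norm_num at e4 e6 e8 e9 e10 e12 e14 e15 e16 e18 e20 e21 e22 e24 e25 e26 e27 b5 t5 b7 t7 b11 t11 b13 t13 b17 t17 b19 t19 b23 t23
  interval_cases n
  · exact abs_Tk_three_sub_le_of_floor_eq hγ₁ (by linarith) hq hk hqx hkx (T := 4) (l := 0.69)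
      (h := 1.12) (p := 1.4) hn (by decide +kernel) (by norm_num) (by norm_num; linarith)
      (by norm_num; linarith) (by norm_num) (by norm_num) (by norm_num)
  · exact abs_Tk_three_sub_le_of_floor_eq hγ₁ (by linarith) hq hk hqx hkx (T := 7) (l := 1.09)
      (h := 1.41) (p := 2.14) hn (by decide +kernel) (by norm_num) (by norm_num; linarith)
      (by norm_num; linarith) (by norm_num) (by norm_num) (by norm_num)
  · exact abs_Tk_three_sub_le_of_floor_eq hγ₁ (by linarith) hq hk hqx hkx (T := 13) (l := 1.38)
      (h := 1.63) (p := 2.8) hn (by decide +kernel) (by norm_num) (by norm_num; linarith)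
      (by norm_num; linarith) (by norm_num) (by norm_num) (by norm_num)
  · exact abs_Tk_three_sub_le_of_floor_eq hγ₁ (by linarith) hq hk hqx hkx (T := 16) (l := 1.6)
      (h := 1.81) (p := 3.41) hn (by decide +kernel) (by norm_num) (by norm_num; linarith)
      (by norm_num; linarith) (by norm_num) (by norm_num) (by norm_num)
  · exact abs_Tk_three_sub_le_of_floor_eq hγ₁ (by linarith) hq hk hqx hkx (T := 25) (l := 1.79)
      (h := 1.97) (p := 4.0) hn (by decide +kernel) (by norm_num) (by norm_num; linarith)
      (by norm_num; linarith) (by norm_num) (by norm_num) (by norm_num)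
  · exact abs_Tk_three_sub_le_of_floor_eq hγ₁ (by linarith) hq hk hqx hkx (T := 28) (l := 1.94)
      (h := 2.1) (p := 4.56) hn (by decide +kernel) (by norm_num) (by norm_num; linarith)
      (by norm_num; linarith) (by norm_num) (by norm_num) (by norm_num)
  · exact abs_Tk_three_sub_le_of_floor_eq hγ₁ (by linarith) hq hk hqx hkx (T := 38) (l := 2.07)
      (h := 2.22) (p := 5.09) hn (by decide +kernel) (by norm_num) (by norm_num; linarith)
      (by norm_num; linarith) (by norm_num) (by norm_num) (by norm_num)
  · exact abs_Tk_three_sub_le_of_floor_eq hγ₁ (by linarith) hq hk hqx hkx (T := 44) (l := 2.19)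
      (h := 2.32) (p := 5.61) hn (by decide +kernel) (by norm_num) (by norm_num; linarith)
      (by norm_num; linarith) (by norm_num) (by norm_num) (by norm_num)
  · exact abs_Tk_three_sub_le_of_floor_eq hγ₁ (by linarith) hq hk hqx hkx (T := 53) (l := 2.3)
      (h := 2.42) (p := 6.12) hn (by decide +kernel) (by norm_num) (by norm_num; linarith)
      (by norm_num; linarith) (by norm_num) (by norm_num) (by norm_num)
  · exact abs_Tk_three_sub_le_of_floor_eq hγ₁ (by linarith) hq hk hqx hkx (T := 56) (l := 2.39)
      (h := 2.5) (p := 6.61) hn (by decide +kernel) (by norm_num) (by norm_num; linarith)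
      (by norm_num; linarith) (by norm_num) (by norm_num) (by norm_num)
  · exact abs_Tk_three_sub_le_of_floor_eq hγ₁ (by linarith) hq hk hqx hkx (T := 74) (l := 2.48)
      (h := 2.58) (p := 7.09) hn (by decide +kernel) (by norm_num) (by norm_num; linarith)
      (by norm_num; linarith) (by norm_num) (by norm_num) (by norm_num)
  · exact abs_Tk_three_sub_le_of_floor_eq hγ₁ (by linarith) hq hk hqx hkx (T := 77) (l := 2.56)
      (h := 2.66) (p := 7.56) hn (by decide +kernel) (by norm_num) (by norm_num; linarith)
      (by norm_num; linarith) (by norm_num) (by norm_num) (by norm_num)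
  · exact abs_Tk_three_sub_le_of_floor_eq hγ₁ (by linarith) hq hk hqx hkx (T := 86) (l := 2.63)
      (h := 2.73) (p := 8.01) hn (by decide +kernel) (by norm_num) (by norm_num; linarith)
      (by norm_num; linarith) (by norm_num) (by norm_num) (by norm_num)
  · exact abs_Tk_three_sub_le_of_floor_eq hγ₁ (by linarith) hq hk hqx hkx (T := 95) (l := 2.7)
      (h := 2.79) (p := 8.46) hn (by decide +kernel) (by norm_num) (by norm_num; linarith)
      (by norm_num; linarith) (by norm_num) (by norm_num) (by norm_num)
  · exact abs_Tk_three_sub_le_of_floor_eq hγ₁ (by linarith) hq hk hqx hkx (T := 110) (l := 2.77)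
      (h := 2.85) (p := 8.91) hn (by decide +kernel) (by norm_num) (by norm_num; linarith)
      (by norm_num; linarith) (by norm_num) (by norm_num) (by norm_num)
  · exact abs_Tk_three_sub_le_of_floor_eq hγ₁ (by linarith) hq hk hqx hkx (T := 113) (l := 2.83)
      (h := 2.91) (p := 9.35) hn (by decide +kernel) (by norm_num) (by norm_num; linarith)
      (by norm_num; linarith) (by norm_num) (by norm_num) (by norm_num)
  · exact abs_Tk_three_sub_le_of_floor_eq hγ₁ (by linarith) hq hk hqx hkx (T := 131) (l := 2.89)
      (h := 2.96) (p := 9.78) hn (by decide +kernel) (by norm_num) (by norm_num; linarith)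
      (by norm_num; linarith) (by norm_num) (by norm_num) (by norm_num)
  · exact abs_Tk_three_sub_le_of_floor_eq hγ₁ (by linarith) hq hk hqx hkx (T := 134) (l := 2.94)
      (h := 3.02) (p := 10.2) hn (by decide +kernel) (by norm_num) (by norm_num; linarith)
      (by norm_num; linarith) (by norm_num) (by norm_num) (by norm_num)
  · exact abs_Tk_three_sub_le_of_floor_eq hγ₁ (by linarith) hq hk hqx hkx (T := 152) (l := 2.99)
      (h := 3.06) (p := 10.61) hn (by decide +kernel) (by norm_num) (by norm_num; linarith)
      (by norm_num; linarith) (by norm_num) (by norm_num) (by norm_num)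
  · exact abs_Tk_three_sub_le_of_floor_eq hγ₁ (by linarith) hq hk hqx hkx (T := 161) (l := 3.04)
      (h := 3.11) (p := 11.02) hn (by decide +kernel) (by norm_num) (by norm_num; linarith)
      (by norm_num; linarith) (by norm_num) (by norm_num) (by norm_num)
  · exact abs_Tk_three_sub_le_of_floor_eq hγ₁ (by linarith) hq hk hqx hkx (T := 170) (l := 3.09)
      (h := 3.16) (p := 11.43) hn (by decide +kernel) (by norm_num) (by norm_num; linarith)
      (by norm_num; linarith) (by norm_num) (by norm_num) (by norm_num)
  · exact abs_Tk_three_sub_le_of_floor_eq hγ₁ (by linarith) hq hk hqx hkx (T := 173) (l := 3.13)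
      (h := 3.2) (p := 11.83) hn (by decide +kernel) (by norm_num) (by norm_num; linarith)
      (by norm_num; linarith) (by norm_num) (by norm_num) (by norm_num)
  · exact abs_Tk_three_sub_le_of_floor_eq hγ₁ (by linarith) hq hk hqx hkx (T := 203) (l := 3.178)
      (h := 3.24) (p := 12.23) hn (by decide +kernel) (by norm_num) (by norm_num; linarith)
      (by norm_num; linarith) (by norm_num) (by norm_num) (by norm_num)
  · exact abs_Tk_three_sub_le_of_floor_eq hγ₁ (by linarith) hq hk hqx hkx (T := 209) (l := 3.21)
      (h := 3.28) (p := 12.61) hn (by decide +kernel) (by norm_num) (by norm_num; linarith)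
      (by norm_num; linarith) (by norm_num) (by norm_num) (by norm_num)
  · exact abs_Tk_three_sub_le_of_floor_eq hγ₁ (by linarith) hq hk hqx hkx (T := 218) (l := 3.25)
      (h := 3.32) (p := 12.99) hn (by decide +kernel) (by norm_num) (by norm_num; linarith)
      (by norm_num; linarith) (by norm_num) (by norm_num) (by norm_num)

theorem stmt_0 (γ₁ : ℝ)
    (hγ₁ : Tendsto
      (fun N : ℕ => (∑ n ∈ Finset.Icc 1 N, Real.log n / n) - (Real.log N) ^ 2 / 2)
      atTop (nhds γ₁)) :
    ∀ x : ℝ, 2 ≤ x →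
      |Tk 3 x - x * ((Real.log x) ^ 2 / 2
          + (3 * Real.eulerMascheroniConstant - 1) * Real.log x
          + 3 * Real.eulerMascheroniConstant ^ 2 - 3 * Real.eulerMascheroniConstant
          - 3 * γ₁ + 1)|
        ≤ 3.369 * x ^ ((2 : ℝ) / 3) * Real.log x ^ ((1 : ℝ) / 3) := by
  intro x hx
  have hx0 : 0 < x := by linarith
  have hL : 0 < log x := log_pos (by linarith)
  have hq : 0 < x ^ ((1 : ℝ) / 3) := rpow_pos_of_pos hx0 _
  have hk : 0 < log x ^ ((1 : ℝ) / 3) := rpow_pos_of_pos hL _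
  have hqx : (x ^ ((1 : ℝ) / 3)) ^ 3 = x := by
    rw [← rpow_natCast, ← rpow_mul hx0.le]; norm_num
  have hkx : (log x ^ ((1 : ℝ) / 3)) ^ 3 = log x := by
    rw [← rpow_natCast, ← rpow_mul hL.le]; norm_num
  have hq2 : x ^ ((2 : ℝ) / 3) = (x ^ ((1 : ℝ) / 3)) ^ 2 := by
    rw [← rpow_natCast, ← rpow_mul hx0.le]; norm_num
  rw [hq2]
  rcases lt_or_ge x 27 with h | h
  · exact abs_Tk_three_sub_le_of_small hγ₁ hx h hq hk hqx hkx
  · exact abs_Tk_three_sub_le_of_large hγ₁ h hq hk hqx hkx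
end

section
/- For every integer k ≥ 3 there exist a real constant C > 0, a real number x₀ ≥ 2, and a real polynomial P_k of degree at most k − 1 with leading coefficient 1/(k−1)! (i.e. the coefficient of the degree-(k−1) term equals 1/(k−1)!) such that for all real x ≥ x₀: |T_k(x) − x·P_k(log x)| ≤ C · x^{(k−1)/k} · (log x)^{(k−1)(k−2)/(2k)}. -/
open Finset Real

theorem exists_real_between {ι : Type*} [Nonempty ι] {l u : ι → ℝ} (h : ∀ i j, l i ≤ u j) :
    ∃ c, ∀ i, l i ≤ c ∧ c ≤ u i := by
  obtain ⟨c, hl, hu⟩ := exists_between_of_forall_le (Set.range_nonempty l) (Set.range_nonempty u)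
    (by rintro _ ⟨i, rfl⟩ _ ⟨j, rfl⟩; exact h i j)
  exact ⟨c, fun i => ⟨hl ⟨i, rfl⟩, hu ⟨i, rfl⟩⟩⟩

/-- Existence of Stieltjes constants, with an error term. -/
theorem exists_sum_log_pow_div_approx (j : ℕ) :
    ∃ (γ : ℝ) (N₀ : ℕ), 1 ≤ N₀ ∧ ∀ N : ℕ, N₀ ≤ N →
      |∑ m ∈ Finset.Icc 1 N, Real.log m ^ j / m - Real.log N ^ (j + 1) / (j + 1) - γ|
        ≤ Real.log N ^ j / N := by
  obtain ⟨N₀, hN₀⟩ := exists_nat_ge (Real.exp j)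
  have hexp : (1 : ℝ) ≤ Real.exp j := Real.one_le_exp (Nat.cast_nonneg j)
  have hN₀1 : (1 : ℝ) ≤ N₀ := hexp.trans hN₀
  set f : ℝ → ℝ := fun t => Real.log t ^ j / t with hf
  have hpos : ∀ t : ℝ, 1 ≤ t → 0 ≤ f t := fun t ht =>
    div_nonneg (pow_nonneg (Real.log_nonneg ht) _) (by linarith)
  have hanti : ∀ s t : ℝ, Real.exp j ≤ s → s ≤ t → f t ≤ f s := by
    intro s t hs hst
    rcases Nat.eq_zero_or_pos j with rfl | hj
    · simp only [hf, pow_zero]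
      have : (0 : ℝ) < s := (Real.exp_pos _).trans_le hs
      gcongr
    · have hj' : (0 : ℝ) < j := by exact_mod_cast hj
      have key : ∀ r : ℝ, 1 ≤ r → f r = (Real.log r / r ^ (1 / (j : ℝ))) ^ j := by
        intro r hr
        rw [div_pow, ← Real.rpow_mul_natCast (by linarith), one_div_mul_cancel hj'.ne',
          Real.rpow_one]
      rw [key s (hexp.trans hs), key t (hexp.trans (hs.trans hst))]
      have h1 : (1 : ℝ) ≤ t := hexp.trans (hs.trans hst)
      have hmem : ∀ r : ℝ, Real.exp j ≤ r → r ∈ Set.Ici (Real.exp (1 / (j : ℝ))⁻¹) := by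
        intro r hr; simpa using hr
      exact pow_le_pow_left₀ (div_nonneg (Real.log_nonneg h1) (by positivity))
        (Real.log_div_self_rpow_antitoneOn (by positivity) (hmem s hs) (hmem t (hs.trans hst))
          hst) j
  set G : ℝ → ℝ := fun t => Real.log t ^ (j + 1) / (j + 1) with hG
  have hder : ∀ t : ℝ, 0 < t → HasDerivAt G (f t) t := by
    intro t ht
    have := ((Real.hasDerivAt_log ht.ne').pow (j + 1)).div_const ((j : ℝ) + 1)
    convert! this using 1
    simp only [hf]
    push_cast
    have : (j : ℝ) + 1 ≠ 0 := by positivity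
    field_simp
  have hstep : ∀ n : ℕ, N₀ ≤ n → f (n + 1 : ℕ) ≤ G (n + 1 : ℕ) - G n ∧
      G (n + 1 : ℕ) - G n ≤ f n := by
    intro n hn
    have hn' : (N₀ : ℝ) ≤ n := by exact_mod_cast hn
    have hn1 : (0 : ℝ) < n := by linarith
    obtain ⟨c, hc, hce⟩ := exists_hasDerivAt_eq_slope G f (a := n) (b := (n + 1 : ℕ))
      (by push_cast; linarith)
      (fun t ht => (hder t (hn1.trans_le ht.1)).continuousAt.continuousWithinAt)
      (fun t ht => hder t (hn1.trans ht.1))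
    have h1 : (((n + 1 : ℕ) : ℝ) - n) = 1 := by push_cast; ring
    rw [h1, div_one] at hce
    rw [← hce]
    exact ⟨hanti _ _ (by linarith [hc.1]) hc.2.le, hanti _ _ (by linarith [hc.1]) hc.1.le⟩
  set A : ℕ → ℝ := fun n => ∑ m ∈ Finset.Icc 1 n, f m - G n with hA
  have hAs : ∀ n, A (n + 1) = A n + f (n + 1 : ℕ) - (G (n + 1 : ℕ) - G n) := by
    intro n
    simp only [hA]
    rw [Finset.sum_Icc_succ_top (by omega)]
    ring
  have hup : Antitone fun i : ℕ => A (N₀ + i) := antitone_nat_of_succ_le fun i => by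
    have := hAs (N₀ + i)
    have := hstep (N₀ + i) (by omega)
    rw [← add_assoc]; linarith
  have hlo : Monotone fun i : ℕ => A (N₀ + i) - f (N₀ + i : ℕ) := monotone_nat_of_le_succ fun i => by
    have := hAs (N₀ + i)
    have := hstep (N₀ + i) (by omega)
    rw [← add_assoc]; linarith
  have hfp : ∀ i : ℕ, 0 ≤ f (N₀ + i : ℕ) := fun i =>
    hpos _ (by push_cast; linarith [Nat.cast_nonneg (α := ℝ) i])
  obtain ⟨γ, hγ⟩ := exists_real_between (l := fun i : ℕ => A (N₀ + i) - f (N₀ + i : ℕ))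
    (u := fun i : ℕ => A (N₀ + i)) (by
      intro i i'
      have h1 := hlo (le_max_left i i')
      have h2 := hup (le_max_right i i')
      have h3 := hfp (max i i')
      simp only at h1 h2 ⊢
      linarith)
  refine ⟨γ, N₀, by exact_mod_cast hN₀1, fun N hN => ?_⟩
  obtain ⟨i, rfl⟩ := Nat.exists_eq_add_of_le hN
  have := hγ i
  simp only [hA, hf, hG] at this
  rw [abs_le]
  have h3 := hfp i
  simp only [hf] at h3
  constructor <;> linarith [this.1, this.2]

theorem exists_abs_eval_le_pow {P : Polynomial ℝ} {d : ℕ} (hP : P.natDegree ≤ d) :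
    ∃ B, 0 ≤ B ∧ ∀ X : ℝ, 1 ≤ X → |P.eval X| ≤ B * X ^ d := by
  refine ⟨∑ i ∈ Finset.range (d + 1), |P.coeff i|, Finset.sum_nonneg fun _ _ => abs_nonneg _,
    fun X hX => ?_⟩
  rw [Polynomial.eval_eq_sum_range' (Nat.lt_succ_of_le hP), Finset.sum_mul]
  refine (Finset.abs_sum_le_sum_abs _ _).trans (Finset.sum_le_sum fun i hi => ?_)
  rw [abs_mul, abs_of_nonneg (pow_nonneg (by linarith : (0 : ℝ) ≤ X) i)]
  have : i ≤ d := by simpa [Nat.lt_succ_iff] using hi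
  gcongr

theorem eval_sub_eq_sum_hasseDeriv {P : Polynomial ℝ} {d : ℕ} (hP : P.natDegree ≤ d) (X Y : ℝ) :
    P.eval (X - Y) =
      ∑ j ∈ Finset.range (d + 1), (-1) ^ j * (Polynomial.hasseDeriv j P).eval X * Y ^ j := by
  have h := Polynomial.taylor_eval X P (-Y)
  rw [Polynomial.eval_eq_sum_range' (n := d + 1)
    (by rw [Polynomial.natDegree_taylor]; omega)] at h
  rw [show X - Y = -Y + X by ring, ← h]
  refine Finset.sum_congr rfl fun j _ => ?_
  rw [Polynomial.taylor_coeff, neg_pow]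
  ring

theorem eval_sub_eval_eq_sum_hasseDeriv {P Q : Polynomial ℝ} {d : ℕ} (hP : P.natDegree ≤ d)
    (hQ : Polynomial.derivative Q = P) (X U : ℝ) :
    Q.eval X - Q.eval (X - U) =
      ∑ j ∈ Finset.range (d + 1),
        (-1) ^ j * (Polynomial.hasseDeriv j P).eval X * (U ^ (j + 1) / (j + 1)) := by
  set F : ℝ → ℝ := fun U => Q.eval X - Q.eval (X - U) - ∑ j ∈ Finset.range (d + 1),
        (-1) ^ j * (Polynomial.hasseDeriv j P).eval X * (U ^ (j + 1) / (j + 1)) with hF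
  have hd : ∀ U, HasDerivAt F 0 U := by
    intro U
    have h1 : HasDerivAt (fun U => Q.eval X - Q.eval (X - U)) (P.eval (X - U)) U := by
      have := ((Q.hasDerivAt (X - U)).comp U ((hasDerivAt_id U).const_sub X)).const_sub (Q.eval X)
      convert! this using 1
      rw [hQ]; ring
    have h2 : HasDerivAt (fun U : ℝ => ∑ j ∈ Finset.range (d + 1),
        (-1) ^ j * (Polynomial.hasseDeriv j P).eval X * (U ^ (j + 1) / (j + 1)))
        (∑ j ∈ Finset.range (d + 1), (-1) ^ j * (Polynomial.hasseDeriv j P).eval X * U ^ j) U := by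
      refine HasDerivAt.fun_sum fun j _ => ?_
      have := ((hasDerivAt_pow (j + 1) U).div_const ((j : ℝ) + 1)).const_mul
        ((-1) ^ j * (Polynomial.hasseDeriv j P).eval X)
      convert! this using 1
      have : (j : ℝ) + 1 ≠ 0 := by positivity
      push_cast
      field_simp
    have := h1.sub h2
    rw [eval_sub_eq_sum_hasseDeriv hP, sub_self] at this
    exact this
  have := is_const_of_deriv_eq_zero (fun U => (hd U).differentiableAt) (fun U => (hd U).deriv) U 0
  have h0 : F 0 = 0 := by simp [hF]
  rw [h0] at this
  simp only [hF] at this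
  linarith

theorem exists_sum_eval_log_approx {P Q : Polynomial ℝ} {d : ℕ} (hP : P.natDegree ≤ d)
    (hQ : Polynomial.derivative Q = P) :
    ∃ (R : Polynomial ℝ) (C : ℝ) (N₀ : ℕ), R.natDegree ≤ d ∧ 0 ≤ C ∧ 1 ≤ N₀ ∧
      ∀ N : ℕ, N₀ ≤ N → ∀ X : ℝ, 1 ≤ X → Real.log N ≤ X →
        |∑ m ∈ Finset.Icc 1 N, P.eval (X - Real.log m) / m
          - (Q.eval X - Q.eval (X - Real.log N)) - R.eval X| ≤ C * X ^ d / N := by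
  choose γ N₀ hN₀ hγ using exists_sum_log_pow_div_approx
  have hdeg : ∀ j, (Polynomial.hasseDeriv j P).natDegree ≤ d - j := fun j =>
    (Polynomial.natDegree_hasseDeriv_le P j).trans (by omega)
  choose B hB0 hB using fun j => exists_abs_eval_le_pow (hdeg j)
  refine ⟨∑ j ∈ Finset.range (d + 1), Polynomial.C ((-1) ^ j * γ j) * Polynomial.hasseDeriv j P,
    ∑ j ∈ Finset.range (d + 1), B j, 1 + ∑ j ∈ Finset.range (d + 1), N₀ j, ?_,
    Finset.sum_nonneg fun j _ => hB0 j, by omega, ?_⟩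
  · refine Polynomial.natDegree_sum_le_of_forall_le _ _ fun j _ => ?_
    exact (Polynomial.natDegree_C_mul_le _ _).trans ((hdeg j).trans (by omega))
  · intro N hN X hX hNX
    have hN1 : (1 : ℝ) ≤ N := by exact_mod_cast (by omega : 1 ≤ N)
    have hlog : 0 ≤ Real.log N := Real.log_nonneg hN1
    have e1 : ∑ m ∈ Finset.Icc 1 N, P.eval (X - Real.log m) / m =
        ∑ j ∈ Finset.range (d + 1), (-1) ^ j * (Polynomial.hasseDeriv j P).eval X *
          ∑ m ∈ Finset.Icc 1 N, Real.log m ^ j / m := by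
      simp_rw [eval_sub_eq_sum_hasseDeriv hP, Finset.sum_div, Finset.mul_sum]
      rw [Finset.sum_comm]
      refine Finset.sum_congr rfl fun j _ => Finset.sum_congr rfl fun m _ => ?_
      ring
    rw [e1, eval_sub_eval_eq_sum_hasseDeriv hP hQ, Polynomial.eval_finsetSum,
      ← Finset.sum_sub_distrib, ← Finset.sum_sub_distrib, Finset.sum_mul, Finset.sum_div]
    refine (Finset.abs_sum_le_sum_abs _ _).trans (Finset.sum_le_sum fun j hj => ?_)
    have hjd : j ≤ d := by simpa [Nat.lt_succ_iff] using hj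
    have hNj : N₀ j ≤ N := by
      have := Finset.single_le_sum (f := N₀) (fun i _ => Nat.zero_le _) hj
      omega
    have h1 := hγ j N hNj
    have h2 := hB j X hX
    rw [Polynomial.eval_mul, Polynomial.eval_C]
    have e2 : ∀ s c g u : ℝ, (-1) ^ j * c * s - (-1) ^ j * c * u - (-1) ^ j * g * c
        = (-1) ^ j * (c * (s - u - g)) := fun s c g u => by ring
    rw [e2, abs_mul, abs_pow, abs_neg, abs_one, one_pow, one_mul, abs_mul]
    calc _ ≤ (B j * X ^ (d - j)) * (Real.log N ^ j / N) :=
          mul_le_mul h2 h1 (abs_nonneg _) (mul_nonneg (hB0 j) (by positivity))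
      _ ≤ (B j * X ^ (d - j)) * (X ^ j / N) := by
          gcongr
          exact mul_nonneg (hB0 j) (by positivity)
      _ = B j * X ^ d / N := by
          rw [← Nat.sub_add_cancel hjd, pow_add]
          simp
          ring

theorem exists_integral_inv_approx {T : ℝ → ℝ} {P Q : Polynomial ℝ} {a b x₀ C : ℝ}
    (hT : Monotone T) (hQ : Polynomial.derivative Q = P) (hb : 0 < b) (ha : 0 ≤ a) (hC : 0 ≤ C)
    (h : ∀ y, x₀ ≤ y → |T y - y * P.eval (Real.log y)| ≤ C * y ^ (1 - b) * Real.log y ^ a) :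
    ∃ c C' v₀ : ℝ, 0 ≤ C' ∧ ∀ v, v₀ ≤ v →
      |(∫ τ in v⁻¹..1, T τ⁻¹) - Q.eval (Real.log v) - c| ≤ C' * v ^ (-b) * Real.log v ^ a := by
  set v₀ : ℝ := max x₀ (Real.exp (2 * a / b + 1)) with hv₀
  have hv₀1 : 1 < v₀ := (Real.one_lt_exp_iff.2 (by positivity)).trans_le (le_max_right _ _)
  have hlogbd : ∀ w : ℝ, 0 < w → w ≤ v₀⁻¹ → x₀ ≤ w⁻¹ ∧ 2 * a / b + 1 ≤ -Real.log w := by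
    intro w hw hwv
    have h1 : v₀ ≤ w⁻¹ := (le_inv_comm₀ (by linarith) hw).2 hwv
    refine ⟨(le_max_left _ _).trans h1, ?_⟩
    rw [← Real.log_inv]
    exact (Real.le_log_iff_exp_le (by positivity)).2 ((le_max_right _ _).trans h1)
  set H : ℝ → ℝ := fun w => (∫ τ in w..1, T τ⁻¹) - Q.eval (-Real.log w) with hH
  set K : ℝ := 2 * C / b with hK
  set F : ℝ → ℝ := fun w => K * (w ^ b * (-Real.log w) ^ a) with hF
  have hint : ∀ r s : ℝ, 0 < r → 0 < s →
      IntervalIntegrable (fun τ => T τ⁻¹) MeasureTheory.volume r s := by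
    intro r s hr hs
    refine AntitoneOn.intervalIntegrable fun t ht t' _ htt => hT ?_
    have : 0 < t := (lt_min hr hs).trans_le ht.1
    gcongr
  have hF0 : ∀ w : ℝ, 0 < w → w ≤ v₀⁻¹ → 0 ≤ F w := by
    intro w hw hwv
    have := (hlogbd w hw hwv).2
    have h2 : 0 ≤ -Real.log w := by
      have : 0 ≤ 2 * a / b := by positivity
      linarith
    positivity
  have key : ∀ w w' : ℝ, 0 < w → w ≤ w' → w' ≤ v₀⁻¹ → |H w - H w'| ≤ F w' - F w := by
    intro w w' hw hww hw'
    have hw'0 : 0 < w' := hw.trans_le hww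
    set F' : ℝ → ℝ := fun τ => K * (b * τ ^ (b - 1) * (-Real.log τ) ^ a
      + τ ^ b * (-τ⁻¹ * a * (-Real.log τ) ^ (a - 1))) with hF'
    have hpos : ∀ τ ∈ Set.Icc w w', 0 < τ ∧ 0 < -Real.log τ := by
      intro τ hτ
      have h0 : 0 < τ := hw.trans_le hτ.1
      have := (hlogbd τ h0 (hτ.2.trans hw')).2
      have : 0 ≤ 2 * a / b := by positivity
      exact ⟨h0, by linarith⟩
    have hFd : ∀ τ ∈ Set.Icc w w', HasDerivAt F (F' τ) τ := by
      intro τ hτ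
      obtain ⟨h0, h1⟩ := hpos τ hτ
      have hl : HasDerivAt (fun τ => (-Real.log τ)) (-τ⁻¹) τ := (Real.hasDerivAt_log h0.ne').neg
      exact ((Real.hasDerivAt_rpow_const (p := b) (Or.inl h0.ne')).mul
        (hl.rpow_const (p := a) (Or.inl h1.ne'))).const_mul K
    have hF'c : ContinuousOn F' (Set.Icc w w') := by
      intro τ hτ
      obtain ⟨h0, h1⟩ := hpos τ hτ
      have hl : ContinuousAt (fun τ => (-Real.log τ)) τ := (Real.continuousAt_log h0.ne').neg
      have hid : ContinuousAt (fun τ : ℝ => τ) τ := continuousAt_id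
      refine ContinuousAt.continuousWithinAt ?_
      exact (((hid.rpow_const (Or.inl h0.ne')).const_mul b |>.mul
        (hl.rpow_const (Or.inl h1.ne'))).add ((hid.rpow_const (Or.inl h0.ne')).mul
          (((hid.inv₀ h0.ne').neg.mul_const a).mul (hl.rpow_const (Or.inl h1.ne'))))).const_mul K
    have hF'i : IntervalIntegrable F' MeasureTheory.volume w w' :=
      ContinuousOn.intervalIntegrable (by rwa [Set.uIcc_of_le hww])
    have hQd : ∀ τ ∈ Set.uIcc w w', HasDerivAt (fun τ => Q.eval (-Real.log τ))
        (-(τ⁻¹ * P.eval (-Real.log τ))) τ := by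
      intro τ hτ
      rw [Set.uIcc_of_le hww] at hτ
      obtain ⟨h0, h1⟩ := hpos τ hτ
      have := (Q.hasDerivAt (-Real.log τ)).comp τ (Real.hasDerivAt_log h0.ne').neg
      convert! this using 1
      rw [hQ]; ring
    have hQi : IntervalIntegrable (fun τ => -(τ⁻¹ * P.eval (-Real.log τ)))
        MeasureTheory.volume w w' := by
      refine ContinuousOn.intervalIntegrable fun τ hτ => ContinuousAt.continuousWithinAt ?_
      rw [Set.uIcc_of_le hww] at hτ
      obtain ⟨h0, h1⟩ := hpos τ hτ
      have hl : ContinuousAt (fun τ => (-Real.log τ)) τ := (Real.continuousAt_log h0.ne').neg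
      exact ((continuousAt_inv₀ h0.ne').mul (P.continuous.continuousAt.comp hl)).neg
    have e1 : H w - H w' = ∫ τ in w..w', (T τ⁻¹ + -(τ⁻¹ * P.eval (-Real.log τ))) := by
      rw [intervalIntegral.integral_add (hint w w' hw hw'0) hQi,
        intervalIntegral.integral_eq_sub_of_hasDerivAt hQd hQi]
      have := intervalIntegral.integral_add_adjacent_intervals (hint w w' hw hw'0)
        (hint w' 1 hw'0 one_pos)
      simp only [hH]
      rw [← this]; ring
    have e2 : F w' - F w = ∫ τ in w..w', F' τ :=
      (intervalIntegral.integral_eq_sub_of_hasDerivAt (by rwa [Set.uIcc_of_le hww]) hF'i).symm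
    rw [e1, e2, ← Real.norm_eq_abs]
    refine intervalIntegral.norm_integral_le_of_norm_le hww
      (Filter.Eventually.of_forall fun τ hτ => ?_) hF'i
    have hτ' : τ ∈ Set.Icc w w' := ⟨hτ.1.le, hτ.2⟩
    obtain ⟨h0, h1⟩ := hpos τ hτ'
    obtain ⟨h2, h3⟩ := hlogbd τ h0 (hτ.2.trans hw')
    have h4 := h τ⁻¹ h2
    rw [Real.log_inv] at h4
    have e3 : (τ⁻¹ : ℝ) ^ (1 - b) = τ ^ (b - 1) := by
      rw [Real.inv_rpow h0.le, ← Real.rpow_neg h0.le]; congr 1; ring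
    rw [e3] at h4
    rw [Real.norm_eq_abs, ← sub_eq_add_neg]
    refine h4.trans ?_
    have e4 : F' τ = K * (τ ^ (b - 1) * (-Real.log τ) ^ (a - 1)) * (b * (-Real.log τ) - a) := by
      have q1 : (-Real.log τ) ^ a = (-Real.log τ) ^ (a - 1) * (-Real.log τ) := by
        rw [← Real.rpow_add_one h1.ne']; congr 1; ring
      have q2 : τ ^ b * τ⁻¹ = τ ^ (b - 1) := by
        rw [Real.rpow_sub_one h0.ne']; rfl
      simp only [hF']
      rw [q1]
      linear_combination (-K * a * (-Real.log τ) ^ (a - 1)) * q2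
    have e5 : C * τ ^ (b - 1) * (-Real.log τ) ^ a
        = K * (τ ^ (b - 1) * (-Real.log τ) ^ (a - 1)) * (b / 2 * (-Real.log τ)) := by
      have q1 : (-Real.log τ) ^ a = (-Real.log τ) ^ (a - 1) * (-Real.log τ) := by
        rw [← Real.rpow_add_one h1.ne']; congr 1; ring
      rw [q1, hK]; field_simp
    rw [e4, e5]
    have h5 : 2 * a ≤ b * (-Real.log τ) := by
      have : 2 * a / b ≤ -Real.log τ := by linarith
      rw [div_le_iff₀ hb] at this; linarith
    refine mul_le_mul_of_nonneg_left (by linarith) ?_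
    have : 0 ≤ K := by positivity
    positivity
  have hne : Nonempty {w : ℝ // 0 < w ∧ w ≤ v₀⁻¹} := ⟨⟨v₀⁻¹, by positivity, le_rfl⟩⟩
  obtain ⟨c, hc⟩ := exists_real_between (ι := {w : ℝ // 0 < w ∧ w ≤ v₀⁻¹})
    (l := fun w => H w - F w) (u := fun w => H w + F w) (by
      rintro ⟨w, hw, hwv⟩ ⟨w', hw', hwv'⟩
      simp only
      have f1 := hF0 w hw hwv
      have f2 := hF0 w' hw' hwv'
      rcases le_total w w' with hh | hh
      · have := abs_le.1 (key w w' hw hh hwv')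
        linarith [this.1, this.2]
      · have := abs_le.1 (key w' w hw' hh hwv)
        linarith [this.1, this.2])
  refine ⟨c, K, v₀, by positivity, fun v hv => ?_⟩
  have hv0 : 0 < v := by linarith
  have := hc ⟨v⁻¹, by positivity, by gcongr⟩
  simp only [hH, hF, Real.log_inv, neg_neg] at this
  rw [Real.inv_rpow hv0.le, ← Real.rpow_neg hv0.le] at this
  rw [abs_le, mul_assoc]
  constructor <;> linarith [this.1, this.2]

theorem abs_sum_sub_integral_le {T : ℝ → ℝ} (hT : Monotone T) (hT0 : ∀ y, y < 1 → T y = 0)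
    {x : ℝ} {N : ℕ} (hN : 1 ≤ N) (hNx : (N : ℝ) ≤ x) :
    |∑ m ∈ Finset.Icc 1 ⌊x⌋₊, T (x / m) - ∑ m ∈ Finset.Icc 1 N, T (x / m)
      - x * ∫ τ in (x / N)⁻¹..1, T τ⁻¹| ≤ T (x / N) := by
  have hN0 : (1 : ℝ) ≤ N := by exact_mod_cast hN
  have hx : 0 < x := by linarith
  set M := ⌊x⌋₊ + 1 with hM
  have hxM : x < M := by rw [hM]; exact_mod_cast Nat.lt_floor_add_one x
  have hNM : N ≤ M := by
    have : (N : ℝ) < M := by linarith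
    exact_mod_cast this.le
  set f : ℝ → ℝ := fun t => T (x / t) with hf
  have hfM : f M = 0 := hT0 _ ((div_lt_one (by linarith)).2 hxM)
  have hanti : AntitoneOn f (Set.Icc N M) := by
    intro s hs t _ hst
    have : 0 < s := by linarith [hs.1]
    exact hT (by gcongr)
  have h1 := hanti.sum_le_integral_Ico hNM
  have h2 := hanti.integral_le_sum_Ico hNM
  have h3 : ∑ m ∈ Finset.Icc 1 M, f m - ∑ m ∈ Finset.Icc 1 N, f m
      = ∑ i ∈ Finset.Ico N M, f (i + 1 : ℕ) := by
    clear_value M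
    clear h1 h2 hanti hfM hxM hM
    induction M, hNM using Nat.le_induction with
    | base => simp
    | succ n hn ih =>
      rw [Finset.sum_Icc_succ_top (by omega), Finset.sum_Ico_succ_top hn, ← ih]; ring
  have h4 : ∑ i ∈ Finset.Ico N M, f (i + 1 : ℕ) = ∑ i ∈ Finset.Ico N M, f i + f M - f N := by
    clear_value M
    clear h1 h2 h3 hanti hfM hxM hM
    induction M, hNM using Nat.le_induction with
    | base => simp
    | succ n hn ih =>
      rw [Finset.sum_Ico_succ_top hn, ih, Finset.sum_Ico_succ_top hn]; ring
  have h5 : ∑ m ∈ Finset.Icc 1 M, f m = ∑ m ∈ Finset.Icc 1 ⌊x⌋₊, f m := by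
    rw [hM, Finset.sum_Icc_succ_top (by omega), ← hM, hfM, add_zero]
  have hint : ∀ r s : ℝ, 0 < r → 0 < s →
      IntervalIntegrable (fun τ => T τ⁻¹) MeasureTheory.volume r s := by
    intro r s hr hs
    refine AntitoneOn.intervalIntegrable fun t ht t' _ htt => hT ?_
    have : 0 < t := (lt_min hr hs).trans_le ht.1
    gcongr
  have h6 : ∫ t in (N : ℝ)..M, f t = x * ∫ τ in (x / N)⁻¹..1, T τ⁻¹ := by
    have e1 : ∀ t : ℝ, f t = (fun τ => T τ⁻¹) (t / x) := fun t => by simp [hf]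
    simp_rw [e1]
    rw [intervalIntegral.integral_comp_div (fun τ => T τ⁻¹) hx.ne', smul_eq_mul, inv_div,
      ← intervalIntegral.integral_add_adjacent_intervals (hint (N / x) 1 (by positivity) one_pos)
        (hint 1 (M / x) one_pos (by positivity))]
    have e2 : ∫ τ in (1 : ℝ)..M / x, T τ⁻¹ = 0 := by
      refine intervalIntegral.integral_zero_ae (Filter.Eventually.of_forall fun τ hτ => ?_)
      rw [Set.uIoc_of_le ((one_le_div hx).2 hxM.le)] at hτ
      exact hT0 _ (inv_lt_one_of_one_lt₀ hτ.1)
    rw [e2, add_zero]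
  have h7 : f N = T (x / N) := rfl
  rw [h6] at h1 h2
  rw [← h7, ← h5, h3, abs_le]
  have h8 : 0 ≤ f N := by
    rw [← hfM]
    exact hanti ⟨le_rfl, by exact_mod_cast hNM⟩ ⟨by exact_mod_cast hNM, le_rfl⟩
      (by exact_mod_cast hNM)
  constructor <;> linarith

theorem sum_rpow_sub_one_le {b : ℝ} (hb : 0 < b) (hb1 : b ≤ 1) (N : ℕ) :
    ∑ m ∈ Finset.Icc 1 N, (m : ℝ) ^ (b - 1) ≤ 1 / b * (N : ℝ) ^ b := by
  induction N with
  | zero => simp [Real.zero_rpow hb.ne']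
  | succ n ih =>
    rw [Finset.sum_Icc_succ_top (by omega)]
    have hn : (0 : ℝ) < (n + 1 : ℕ) := by positivity
    set y : ℝ := ((n + 1 : ℕ) : ℝ) with hy
    have hy1 : 1 ≤ y := by rw [hy]; push_cast; linarith [Nat.cast_nonneg (α := ℝ) n]
    have h1 : y ^ (b - 1) = y ^ b * y⁻¹ := by rw [Real.rpow_sub_one hn.ne']; rfl
    have h2 := rpow_one_add_le_one_add_mul_self (s := -y⁻¹)
      (by linarith [inv_le_one_of_one_le₀ hy1]) hb.le hb1
    have h3 : (n : ℝ) = y * (1 + -y⁻¹) := by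
      rw [mul_add, mul_neg, mul_inv_cancel₀ hn.ne', hy]; push_cast; ring
    have h4 : (n : ℝ) ^ b ≤ y ^ b * (1 + b * -y⁻¹) := by
      rw [h3, Real.mul_rpow hn.le (by linarith [inv_le_one_of_one_le₀ hy1])]
      gcongr
    rw [h1]
    calc _ ≤ 1 / b * (y ^ b * (1 + b * -y⁻¹)) + y ^ b * y⁻¹ := by
          gcongr
          exact ih.trans (by gcongr)
      _ = 1 / b * y ^ b := by field_simp; ring

theorem Tk_monotone (k : ℕ) : Monotone (Tk k) := by
  intro x y hxy
  refine Finset.sum_le_sum_of_subset_of_nonneg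
    (Finset.Icc_subset_Icc le_rfl (Nat.floor_le_floor hxy)) fun _ _ _ => Nat.cast_nonneg _

theorem Tk_eq_zero_of_lt_one (k : ℕ) {x : ℝ} (hx : x < 1) : Tk k x = 0 := by
  simp [Tk, Nat.floor_eq_zero.2 hx]

theorem Tk_succ (k : ℕ) (x : ℝ) :
    Tk (k + 1) x = ∑ m ∈ Finset.Icc 1 ⌊x⌋₊, Tk k (x / m) := by
  have h := ArithmeticFunction.sum_Ioc_mul_eq_sum_sum (ArithmeticFunction.zeta)
    (ArithmeticFunction.zeta ^ k) ⌊x⌋₊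
  have e : ∀ n : ℕ, Finset.Ioc 0 n = Finset.Icc 1 n := fun n => rfl
  simp only [e] at h
  simp only [Tk, dk, pow_succ']
  rw [← Nat.cast_sum, h, Nat.cast_sum]
  refine Finset.sum_congr rfl fun m hm => ?_
  have hm1 : m ≠ 0 := by have := (Finset.mem_Icc.1 hm).1; omega
  rw [Nat.floor_div_natCast, ArithmeticFunction.zeta_apply_ne hm1, one_mul, Nat.cast_sum]

theorem Tk_one (x : ℝ) : Tk 1 x = ⌊x⌋₊ := by
  simp only [Tk, dk, pow_one]
  rw [← Nat.cast_sum]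
  congr 1
  exact ArithmeticFunction.sum_Ioc_zeta _

theorem exists_Tk_succ_approx {k d : ℕ} {P Q : Polynomial ℝ} {a b C x₀ : ℝ}
    (hP : P.natDegree ≤ d) (hQ : Polynomial.derivative Q = P) (hb : 0 < b) (hb1 : b ≤ 1)
    (ha : 0 ≤ a) (had : a ≤ d) (hC : 0 ≤ C)
    (h : ∀ y, x₀ ≤ y → |Tk k y - y * P.eval (Real.log y)| ≤ C * y ^ (1 - b) * Real.log y ^ a) :
    ∃ (R : Polynomial ℝ) (C' v₁ : ℝ) (N₀ : ℕ), R.natDegree ≤ d ∧ 0 ≤ C' ∧ 1 ≤ v₁ ∧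
      ∀ (x : ℝ) (N : ℕ), N₀ ≤ N → v₁ * N ≤ x →
        |Tk (k + 1) x - x * (Q + R).eval (Real.log x)|
          ≤ C' * (x * (x / N) ^ (-b) * Real.log x ^ a + x / N * Real.log x ^ d) := by
  obtain ⟨R, C₄, N₁, hR, hC₄, hN₁, hsum⟩ := exists_sum_eval_log_approx hP hQ
  obtain ⟨c, C₃, v₀, hC₃, hI⟩ := exists_integral_inv_approx (Tk_monotone k) hQ hb ha hC h
  obtain ⟨B, hB, hPB⟩ := exists_abs_eval_le_pow hP
  refine ⟨R + Polynomial.C c, C / b + C₃ + B + C + C₄, max (max x₀ v₀) (Real.exp 1), N₁,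
    (Polynomial.natDegree_add_C).trans_le hR, by positivity,
    le_max_of_le_right (Real.one_le_exp zero_le_one), fun x N hN hvx => ?_⟩
  have hN1 : 1 ≤ N := hN₁.trans hN
  have hN0 : (1 : ℝ) ≤ N := by exact_mod_cast hN1
  have hNpos : (0 : ℝ) < N := by linarith
  set v := x / N with hv
  have hv1 : max (max x₀ v₀) (Real.exp 1) ≤ v := (le_div_iff₀ hNpos).2 hvx
  have hve : Real.exp 1 ≤ v := (le_max_right _ _).trans hv1
  have hvx₀ : x₀ ≤ v := ((le_max_left _ _).trans (le_max_left _ _)).trans hv1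
  have hvv₀ : v₀ ≤ v := ((le_max_right _ _).trans (le_max_left _ _)).trans hv1
  have hvone : 1 ≤ v := (Real.one_le_exp zero_le_one).trans hve
  have hv0 : 0 < v := by linarith
  have hlogv : 1 ≤ Real.log v := (Real.le_log_iff_exp_le hv0).2 hve
  have hxv : x = v * N := by rw [hv]; field_simp
  have hx0 : 0 < x := by rw [hxv]; positivity
  have hNx : (N : ℝ) ≤ x := by rw [hxv]; nlinarith
  set X := Real.log x with hX
  have hlogN : 0 ≤ Real.log N := Real.log_nonneg hN0
  have hXv : Real.log v = X - Real.log N := Real.log_div hx0.ne' hNpos.ne'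
  have hX1 : 1 ≤ X := by linarith
  have hvX : Real.log v ≤ X := by linarith
  have hvXa : Real.log v ^ a ≤ X ^ a := Real.rpow_le_rpow (by linarith) hvX ha
  have hXad : X ^ a ≤ X ^ d := by
    rw [← Real.rpow_natCast]
    exact Real.rpow_le_rpow_of_exponent_le hX1 had
  have d1 : |∑ m ∈ Finset.Icc 1 N, Tk k (x / m)
      - x * ∑ m ∈ Finset.Icc 1 N, P.eval (X - Real.log m) / m|
      ≤ C / b * (x * v ^ (-b) * X ^ a) := by
    rw [Finset.mul_sum, ← Finset.sum_sub_distrib]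
    calc _ ≤ ∑ m ∈ Finset.Icc 1 N, C * x ^ (1 - b) * X ^ a * (m : ℝ) ^ (b - 1) := by
          refine (Finset.abs_sum_le_sum_abs _ _).trans (Finset.sum_le_sum fun m hm => ?_)
          obtain ⟨hm1, hmN⟩ := Finset.mem_Icc.1 hm
          have hm1' : (1 : ℝ) ≤ m := by exact_mod_cast hm1
          have hmN' : (m : ℝ) ≤ N := by exact_mod_cast hmN
          have hm0 : (0 : ℝ) < m := by linarith
          have hvm : v ≤ x / m := by rw [hv]; gcongr
          have h1 := h (x / m) (hvx₀.trans hvm)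
          have h2 : Real.log (x / m) = X - Real.log m := Real.log_div hx0.ne' hm0.ne'
          have h3 : 0 ≤ Real.log (x / m) := Real.log_nonneg (hvone.trans hvm)
          have h4 : (x / m) ^ (1 - b) = x ^ (1 - b) * (m : ℝ) ^ (b - 1) := by
            rw [Real.div_rpow hx0.le hm0.le, div_eq_mul_inv, ← Real.rpow_neg hm0.le, neg_sub]
          have h5 : Real.log (x / m) ^ a ≤ X ^ a :=
            Real.rpow_le_rpow h3 (by linarith [Real.log_nonneg hm1']) ha
          rw [← h2]
          calc _ = |Tk k (x / m) - x / m * P.eval (Real.log (x / m))| := by congr 1; ring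
            _ ≤ C * (x / m) ^ (1 - b) * X ^ a := h1.trans (by gcongr)
            _ = _ := by rw [h4]; ring
      _ ≤ C * x ^ (1 - b) * X ^ a * (1 / b * (N : ℝ) ^ b) := by
          rw [← Finset.mul_sum]
          gcongr
          exact sum_rpow_sub_one_le hb hb1 N
      _ = _ := by
          rw [hv, Real.div_rpow hx0.le hNpos.le, Real.rpow_neg hNpos.le, div_inv_eq_mul,
            sub_eq_add_neg, Real.rpow_add hx0, Real.rpow_one]
          ring
  have d2 : Tk k v ≤ (B + C) * (v * X ^ d) := by
    have h1 := (abs_le.1 (h v hvx₀)).2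
    have h2 := (abs_le.1 (hPB _ hlogv)).2
    have h3 : v * P.eval (Real.log v) ≤ v * (B * X ^ d) := by
      gcongr
      exact h2.trans (by gcongr)
    have h4 : C * v ^ (1 - b) * Real.log v ^ a ≤ C * v * X ^ d := by
      gcongr
      · calc v ^ (1 - b) ≤ v ^ (1 : ℝ) := Real.rpow_le_rpow_of_exponent_le hvone (by linarith)
          _ = v := Real.rpow_one v
      · exact hvXa.trans hXad
    linarith
  have d3 : |x * ((∫ τ in v⁻¹..1, Tk k τ⁻¹) - Q.eval (Real.log v) - c)|
      ≤ C₃ * (x * v ^ (-b) * X ^ a) := by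
    rw [abs_mul, abs_of_pos hx0]
    calc _ ≤ x * (C₃ * v ^ (-b) * X ^ a) := by
          gcongr
          exact (hI v hvv₀).trans (by gcongr)
      _ = _ := by ring
  have d4 := hsum N hN X hX1 (by linarith)
  rw [← hXv] at d4
  replace d4 : |x * (∑ m ∈ Finset.Icc 1 N, P.eval (X - Real.log m) / m
      - (Q.eval X - Q.eval (Real.log v)) - R.eval X)| ≤ C₄ * (v * X ^ d) := by
    rw [abs_mul, abs_of_pos hx0]
    calc _ ≤ x * (C₄ * X ^ d / N) := by gcongr
      _ = _ := by rw [hv]; ring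
  have d5 := abs_sum_sub_integral_le (Tk_monotone k) (fun y hy => Tk_eq_zero_of_lt_one k hy)
    hN1 hNx
  rw [← Tk_succ, ← hv] at d5
  have hE1 : 0 ≤ x * v ^ (-b) * X ^ a := by positivity
  have hE2 : 0 ≤ v * X ^ d := by positivity
  have hCb : 0 ≤ C / b := by positivity
  rw [abs_le] at d1 d3 d4 d5 ⊢
  simp only [Polynomial.eval_add, Polynomial.eval_C]
  have p1 := mul_nonneg hCb hE2
  have p2 := mul_nonneg hC₃ hE2
  have p3 := mul_nonneg hB hE1
  have p4 := mul_nonneg hC hE1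
  have p5 := mul_nonneg hC₄ hE1
  obtain ⟨d1, d1'⟩ := d1
  obtain ⟨d3, d3'⟩ := d3
  obtain ⟨d4, d4'⟩ := d4
  obtain ⟨d5, d5'⟩ := d5
  constructor <;> linarith

theorem exists_nat_near_rpow_mul_log_rpow {s β : ℝ} (hs : 0 < s) (hs1 : s < 1) (hβ : 0 ≤ β)
    (v₁ : ℝ) (hv₁ : 1 ≤ v₁) (N₀ : ℕ) :
    ∃ x₁ : ℝ, 3 ≤ x₁ ∧ ∀ x, x₁ ≤ x → ∃ N : ℕ, N₀ ≤ N ∧ v₁ * N ≤ x ∧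
      x ^ s * Real.log x ^ β ≤ N ∧ N ≤ 2 * (x ^ s * Real.log x ^ β) := by
  have h1 := (isLittleO_log_rpow_rpow_atTop β (sub_pos.2 hs1)).bound
    (c := 1 / (2 * v₁)) (by positivity)
  have h2 := (tendsto_rpow_atTop hs).eventually_ge_atTop (max 1 (N₀ : ℝ))
  obtain ⟨x₁, hx₁⟩ := Filter.eventually_atTop.1 ((h1.and h2).and (Filter.eventually_ge_atTop 3))
  refine ⟨max x₁ 3, le_max_right _ _, fun x hx => ?_⟩
  obtain ⟨⟨h3, h4⟩, h5⟩ := hx₁ x ((le_max_left _ _).trans hx)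
  have hx0 : 0 < x := by linarith
  have hL : 1 ≤ Real.log x :=
    (Real.le_log_iff_exp_le hx0).2 (by linarith [Real.exp_one_lt_d9])
  set y := x ^ s * Real.log x ^ β with hy
  have hyx : x ^ s ≤ y := le_mul_of_one_le_right (by positivity) (Real.one_le_rpow hL hβ)
  have hy1 : max 1 (N₀ : ℝ) ≤ y := h4.trans hyx
  have hy1' : 1 ≤ y := (le_max_left _ _).trans hy1
  have hceil := (Nat.ceil_lt_add_one (by linarith : 0 ≤ y)).le
  have hN2 : (⌈y⌉₊ : ℝ) ≤ 2 * y := by linarith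
  refine ⟨⌈y⌉₊, ?_, ?_, Nat.le_ceil y, hN2⟩
  · have : (N₀ : ℝ) ≤ ⌈y⌉₊ := ((le_max_right _ _).trans hy1).trans (Nat.le_ceil y)
    exact_mod_cast this
  · rw [Real.norm_of_nonneg (by positivity), Real.norm_of_nonneg (by positivity)] at h3
    have h6 : y ≤ x ^ s * (1 / (2 * v₁) * x ^ (1 - s)) := by rw [hy]; gcongr
    have h7 : x ^ s * x ^ (1 - s) = x := by
      rw [← Real.rpow_add hx0]; simp
    calc v₁ * (⌈y⌉₊ : ℝ) ≤ v₁ * (2 * y) := by gcongr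
      _ ≤ v₁ * (2 * (x ^ s * (1 / (2 * v₁) * x ^ (1 - s)))) := by gcongr
      _ = x ^ s * x ^ (1 - s) := by field_simp
      _ = x := h7

theorem exists_polynomial_derivative_eq (P : Polynomial ℝ) (d : ℕ) (hP : P.natDegree ≤ d) :
    ∃ Q : Polynomial ℝ, Polynomial.derivative Q = P ∧ Q.natDegree ≤ d + 1 ∧
      Q.coeff (d + 1) = P.coeff d / (d + 1) := by
  refine ⟨∑ i ∈ Finset.range (d + 1), Polynomial.monomial (i + 1) (P.coeff i / (i + 1)), ?_, ?_, ?_⟩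
  · conv_rhs => rw [P.as_sum_range' (d + 1) (by omega)]
    rw [Polynomial.derivative_sum]
    refine Finset.sum_congr rfl fun i _ => ?_
    rw [Polynomial.derivative_monomial]
    have : (i : ℝ) + 1 ≠ 0 := by positivity
    congr 1
    push_cast
    field_simp
  · refine Polynomial.natDegree_sum_le_of_forall_le _ _ fun i hi => ?_
    have := Finset.mem_range.1 hi
    exact (Polynomial.natDegree_monomial_le _).trans (by omega)
  · simp [Polynomial.coeff_monomial]

theorem Tk_asymptotic (k : ℕ) (hk : 1 ≤ k) :
    ∃ (C : ℝ) (x₀ : ℝ) (P : Polynomial ℝ), 0 < C ∧ 2 ≤ x₀ ∧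
      P.natDegree ≤ k - 1 ∧ P.coeff (k - 1) = 1 / (Nat.factorial (k - 1) : ℝ) ∧
      ∀ x : ℝ, x₀ ≤ x →
        |Tk k x - x * P.eval (Real.log x)|
          ≤ C * x ^ (((k : ℝ) - 1) / k)
              * Real.log x ^ (((k : ℝ) - 1) * ((k : ℝ) - 2) / (2 * k)) := by
  induction k, hk using Nat.le_induction with
  | base =>
    refine ⟨1, 2, 1, one_pos, le_rfl, by simp, by simp, fun x hx => ?_⟩
    have h1 := Nat.floor_le (by linarith : 0 ≤ x)
    have h2 := Nat.lt_floor_add_one x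
    rw [Tk_one, abs_le]
    norm_num
    constructor <;> linarith
  | succ k hk ih =>
    obtain ⟨C, x₀, P, hC, _, hdeg, hcoeff, h⟩ := ih
    obtain ⟨d, rfl⟩ := Nat.exists_eq_add_of_le' hk
    simp only [Nat.add_sub_cancel] at hdeg hcoeff ⊢
    have hd0 : (0 : ℝ) ≤ d := Nat.cast_nonneg d
    push_cast at h
    set κ : ℝ := (d : ℝ) + 1 with hκ
    have hκ0 : 0 < κ := by linarith
    set a : ℝ := (κ - 1) * (κ - 2) / (2 * κ) with ha
    have ha0 : 0 ≤ a := by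
      rcases Nat.eq_zero_or_pos d with rfl | hd
      · simp [ha, hκ]
      · have : (1 : ℝ) ≤ d := by exact_mod_cast hd
        exact div_nonneg (mul_nonneg (by linarith) (by linarith)) (by linarith)
    have had : a ≤ d := by
      rw [ha, div_le_iff₀ (by linarith), hκ]; nlinarith
    obtain ⟨Q, hQ, hQd, hQc⟩ := exists_polynomial_derivative_eq P d hdeg
    obtain ⟨R, C', v₁, N₀, hR, hC', hv₁, hmain⟩ := exists_Tk_succ_approx (k := d + 1) (x₀ := x₀)
      (b := 1 / κ) (a := a) hdeg hQ (by positivity)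
      ((div_le_one hκ0).2 (by linarith)) ha0 had hC.le (by
        intro y hy
        convert h y hy using 4
        field_simp)
    set β : ℝ := (κ - 1) * (κ + 2) / (2 * (κ + 1)) with hβ
    have hβ0 : 0 ≤ β := div_nonneg (mul_nonneg (by linarith) (by linarith)) (by linarith)
    obtain ⟨x₁, hx₁, hN⟩ := exists_nat_near_rpow_mul_log_rpow (s := 1 / (κ + 1)) (β := β)
      (by positivity) ((div_lt_one (by linarith)).2 (by linarith)) hβ0 v₁ hv₁ (N₀ + 1)
    refine ⟨3 * (C' + 1), x₁, Q + R, by positivity, by linarith, ?_, ?_, fun x hx => ?_⟩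
    · exact (Polynomial.natDegree_add_le _ _).trans (max_le hQd (hR.trans (by omega)))
    · rw [Polynomial.coeff_add, hQc, hcoeff,
        Polynomial.coeff_eq_zero_of_natDegree_lt (show R.natDegree < d + 1 by omega),
        Nat.factorial_succ]
      push_cast
      field_simp
      simp
    · obtain ⟨N, hN₀, hvN, hyN, hNy⟩ := hN x hx
      have hx0 : 0 < x := by linarith
      have hL : 1 ≤ Real.log x :=
        (Real.le_log_iff_exp_le hx0).2 (by linarith [Real.exp_one_lt_d9])
      have hL0 : 0 < Real.log x := by linarith
      have hm := hmain x N (by omega) hvN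
      set y := x ^ (1 / (κ + 1)) * Real.log x ^ β with hy
      have hy0 : 0 < y := by positivity
      have hNpos : (0 : ℝ) < N := hy0.trans_le hyN
      push_cast
      rw [← hκ]
      set E := x ^ ((κ + 1 - 1) / (κ + 1)) *
        Real.log x ^ ((κ + 1 - 1) * (κ + 1 - 2) / (2 * (κ + 1))) with hE
      have hE0 : 0 ≤ E := by positivity
      have g1 : x * (x / N) ^ (-(1 / κ)) * Real.log x ^ a ≤ 2 * E := by
        have e1 : (x / N) ^ (-(1 / κ)) = x ^ (-(1 / κ)) * (N : ℝ) ^ (1 / κ) := by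
          rw [Real.div_rpow hx0.le hNpos.le, Real.rpow_neg hNpos.le, div_inv_eq_mul]
        have e2 : (N : ℝ) ^ (1 / κ) ≤ 2 * y ^ (1 / κ) := by
          calc (N : ℝ) ^ (1 / κ) ≤ (2 * y) ^ (1 / κ) :=
                Real.rpow_le_rpow hNpos.le hNy (by positivity)
            _ = 2 ^ (1 / κ) * y ^ (1 / κ) := Real.mul_rpow zero_le_two hy0.le
            _ ≤ 2 ^ (1 : ℝ) * y ^ (1 / κ) := by
                gcongr
                · exact one_le_two
                · exact (div_le_one hκ0).2 (by linarith)
            _ = 2 * y ^ (1 / κ) := by rw [Real.rpow_one]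
        have e3 : y ^ (1 / κ) = x ^ (1 / (κ + 1) * (1 / κ)) * Real.log x ^ (β * (1 / κ)) := by
          rw [hy, Real.mul_rpow (by positivity) (by positivity), ← Real.rpow_mul hx0.le,
            ← Real.rpow_mul hL0.le]
        have e4 : E = (x ^ (1 : ℝ) * x ^ (-(1 / κ)) * x ^ (1 / (κ + 1) * (1 / κ))) *
            (Real.log x ^ (β * (1 / κ)) * Real.log x ^ a) := by
          rw [← Real.rpow_add hx0, ← Real.rpow_add hx0, ← Real.rpow_add hL0, hE]
          congr 2
          · field_simp; ring
          · rw [hβ, ha]; field_simp; ring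
        calc _ ≤ x * (x ^ (-(1 / κ)) * (2 * y ^ (1 / κ))) * Real.log x ^ a := by
              rw [e1]; gcongr
          _ = 2 * E := by rw [e4, e3, Real.rpow_one]; ring
      have g2 : x / N * Real.log x ^ d ≤ E := by
        have e4 : E = (x ^ (1 : ℝ) * x ^ (-(1 / (κ + 1)))) *
            (Real.log x ^ (-β) * Real.log x ^ (d : ℝ)) := by
          rw [← Real.rpow_add hx0, ← Real.rpow_add hL0, hE]
          congr 2
          · field_simp; ring
          · rw [hβ, show (d : ℝ) = κ - 1 by rw [hκ]; ring]; field_simp; ring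
        calc _ ≤ x / y * Real.log x ^ d := by gcongr
          _ = E := by
            rw [e4, Real.rpow_natCast, Real.rpow_one, Real.rpow_neg hx0.le, Real.rpow_neg hL0.le,
              hy]
            field_simp
      calc _ ≤ _ := hm
        _ ≤ C' * (2 * E + E) := by gcongr
        _ ≤ 3 * (C' + 1) * E := by linarith
        _ = _ := by rw [hE]; ring

theorem stmt_1 (k : ℕ) (hk : 3 ≤ k) :
    ∃ (C : ℝ) (x₀ : ℝ) (P : Polynomial ℝ), 0 < C ∧ 2 ≤ x₀ ∧
      P.natDegree ≤ k - 1 ∧ P.coeff (k - 1) = 1 / (Nat.factorial (k - 1) : ℝ) ∧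
      ∀ x : ℝ, x₀ ≤ x →
        |Tk k x - x * P.eval (Real.log x)|
          ≤ C * x ^ (((k : ℝ) - 1) / k)
              * Real.log x ^ (((k : ℝ) - 1) * ((k : ℝ) - 2) / (2 * k)) := by
  exact Tk_asymptotic k (by omega)
end
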